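/- arXiv:2507.14974 — 2 statements merged into one kernel-verified Lean document; each statement's English description precedes it below -/
import Mathlib

section
/- Let n ≥ 1, suppose (1/p, 1/q) lies on the half-open segment (A, B] (so that 2/q + n/p = n and (n−1)/(n+1) < 1/p ≤ 1), and let α > 2p/(p+1). Then there is no finite constant C such that ‖ Σ_j λ_j |e^{itΔ}f_j|² ‖_{L^q(ℝ, L^p(ℝⁿ))} ≤ C ‖{λ_j}‖_{ℓ^α} holds for all families {f_j} orthonormal in L²(ℝⁿ) and all {λ_j} ∈ ℓ^α. -/
noncomputable section

open MeasureTheory ENNReal Real Set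

namespace OS

/-- `ℝⁿ` as a Euclidean space. -/
abbrev Rn (n : ℕ) := EuclideanSpace ℝ (Fin n)

/-- The real dot product `x·ξ`, viewed as a complex number. -/
def dotC {n : ℕ} (x ξ : Rn n) : ℂ := ((∑ i, x i * ξ i : ℝ) : ℂ)

/-- The Fourier transform `f̂(ξ) = ∫ f(x) e^{-i x·ξ} dx`. -/
def FT {n : ℕ} (f : Rn n → ℂ) (ξ : Rn n) : ℂ :=
  ∫ x : Rn n, Complex.exp (-(Complex.I * dotC x ξ)) * f x

/-- The propagator `e^{itΔ}` composed with a Fourier multiplier `m`: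
`x ↦ (2π)^{-n} ∫ e^{i(x·ξ - t|ξ|²)} m(ξ) f̂(ξ) dξ`. -/
def prop {n : ℕ} (m : Rn n → ℂ) (f : Rn n → ℂ) (t : ℝ) (x : Rn n) : ℂ :=
  ((2 * π : ℝ) ^ (-(n : ℝ)) : ℝ) •
    ∫ ξ : Rn n, Complex.exp (Complex.I * (dotC x ξ - (t : ℂ) * ((‖ξ‖ : ℝ) : ℂ) ^ 2)) *
      (m ξ * FT f ξ)

/-- The free Schrödinger propagator `e^{itΔ} f`, as a function of `(t, x)`. -/
def schrodinger {n : ℕ} (f : Rn n → ℂ) : ℝ → Rn n → ℂ := prop (fun _ => 1) f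

/-- The Fourier multiplier `|ξ|^{-s} ψ(2^{-k}|ξ|)` of `(-Δ)^{-s/2} P_k`. -/
def LPmult {n : ℕ} (s : ℝ) (ψ : ℝ → ℝ) (k : ℤ) (ξ : Rn n) : ℂ :=
  ((‖ξ‖ ^ (-s) * ψ ((2 : ℝ) ^ (-k) * ‖ξ‖) : ℝ) : ℂ)

/-- The Littlewood–Paley projection `P_k h`. -/
def LP {n : ℕ} (ψ : ℝ → ℝ) (k : ℤ) (h : Rn n → ℂ) (x : Rn n) : ℂ :=
  ((2 * π : ℝ) ^ (-(n : ℝ)) : ℝ) •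
    ∫ ξ : Rn n, Complex.exp (Complex.I * dotC x ξ) *
      (((ψ ((2 : ℝ) ^ (-k) * ‖ξ‖) : ℝ) : ℂ) * FT h ξ)

/-- The standing hypotheses on the Littlewood–Paley bump function `ψ`:
smooth, `[0,1]`-valued, supported in `[1/2,2]`, with `∑_{k∈ℤ} ψ(2^{-k} r) = 1` for `r ≠ 0`. -/
structure IsLPF (ψ : ℝ → ℝ) : Prop where
  smooth : ContDiff ℝ (⊤ : ℕ∞) ψ
  mem_Icc : ∀ r, ψ r ∈ Icc (0 : ℝ) 1
  supp : Function.support ψ ⊆ Icc (1 / 2 : ℝ) 2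
  sum_one : ∀ r : ℝ, r ≠ 0 → ∑' k : ℤ, ψ ((2 : ℝ) ^ (-k) * r) = 1

/-- Orthonormality in `L²(ℝⁿ)`. -/
def OrthonormalL2 {n : ℕ} (f : ℕ → Rn n → ℂ) : Prop :=
  ∀ j k, (∫ x : Rn n, f j x * (starRingEnd ℂ) (f k x)) = if j = k then 1 else 0

/-- Orthonormality in the homogeneous Sobolev space `Ḣ^s(ℝⁿ)`:
`(2π)^{-n} ∫ |ξ|^{2s} f̂_j(ξ) conj(f̂_k(ξ)) dξ = δ_{jk}`. -/
def OrthonormalHs {n : ℕ} (s : ℝ) (f : ℕ → Rn n → ℂ) : Prop :=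
  ∀ j k, ((2 * π : ℝ) ^ (-(n : ℝ)) : ℝ) •
    (∫ ξ : Rn n, ((‖ξ‖ ^ (2 * s) : ℝ) : ℂ) * (FT (f j) ξ * (starRingEnd ℂ) (FT (f k) ξ)))
      = if j = k then 1 else 0

/-- The density `Σ_j λ_j |u_j(t,x)|²` of a system of space-time functions. -/
def density2 {n : ℕ} (lam : ℕ → ℝ) (u : ℕ → ℝ → Rn n → ℂ) (t : ℝ) (x : Rn n) : ℝ :=
  ∑' j, lam j * ‖u j t x‖ ^ 2

/-- The density `Σ_j λ_j |e^{itΔ}f_j(x)|²`. -/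
def density {n : ℕ} (lam : ℕ → ℝ) (f : ℕ → Rn n → ℂ) : ℝ → Rn n → ℝ :=
  density2 lam fun j => schrodinger (f j)

/-- The `L^q` norm (w.r.t. `μ`) of an `ℝ≥0∞`-valued function. -/
def eLp {α : Type*} [MeasurableSpace α] (μ : Measure α) (q : ℝ≥0∞) (F : α → ℝ≥0∞) : ℝ≥0∞ :=
  if q = ∞ then essSup F μ
  else (∫⁻ t, F t ^ q.toReal ∂μ) ^ (1 / q.toReal)

/-- The Lorentz `L^{p,r}` (quasi)norm of an `ℝ≥0∞`-valued function, via the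
distribution function.  For `r = ∞` this is the weak-`L^p` quasinorm
`sup_{s>0} s μ(G > s)^{1/p} = sup_{t>0} t^{1/p} G^*(t)`. -/
def lor {α : Type*} [MeasurableSpace α] (μ : Measure α) (p r : ℝ≥0∞) (G : α → ℝ≥0∞) : ℝ≥0∞ :=
  if p = ∞ then essSup G μ
  else if r = ∞ then
    ⨆ (s : ℝ) (_ : 0 < s), ENNReal.ofReal s * μ {x | ENNReal.ofReal s < G x} ^ (1 / p.toReal)
  else
    (∫⁻ s in Ioi (0 : ℝ),
      (ENNReal.ofReal s * μ {x | ENNReal.ofReal s < G x} ^ (1 / p.toReal)) ^ r.toReal *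
        (ENNReal.ofReal s)⁻¹) ^ (1 / r.toReal)

/-- The mixed norm `‖u‖_{L^q(ℝ, L^p(ℝⁿ))}`. -/
def mixedLp {n : ℕ} {E : Type*} [NormedAddCommGroup E] (q p : ℝ≥0∞)
    (u : ℝ → Rn n → E) : ℝ≥0∞ :=
  eLp volume q fun t => eLpNorm (u t) p volume

/-- The mixed norm `‖u‖_{L^{q,∞}(ℝ, L^p(ℝⁿ))}` (weak in time). -/
def mixedWeakLp {n : ℕ} {E : Type*} [NormedAddCommGroup E] (q p : ℝ≥0∞)
    (u : ℝ → Rn n → E) : ℝ≥0∞ :=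
  lor volume q ∞ fun t => eLpNorm (u t) p volume

/-- The weak `L^{p,∞}(ℝⁿ)` quasinorm. -/
def wLp {n : ℕ} {E : Type*} [NormedAddCommGroup E] (p : ℝ≥0∞) (g : Rn n → E) : ℝ≥0∞ :=
  lor volume p ∞ fun x => (‖g x‖₊ : ℝ≥0∞)

/-- The mixed Lorentz norm `‖u‖_{L^{q,r}(ℝ, L^{p,r̃}(ℝⁿ))}`. -/
def mixedLorentz {n : ℕ} {E : Type*} [NormedAddCommGroup E] (q r p rt : ℝ≥0∞)
    (u : ℝ → Rn n → E) : ℝ≥0∞ :=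
  lor volume q r fun t => lor volume p rt fun x => (‖u t x‖₊ : ℝ≥0∞)

/-- The `ℓ^a` norm of a sequence (with `ℓ^∞` the supremum norm). -/
def seqNormE (a : ℝ≥0∞) (lam : ℕ → ℝ) : ℝ≥0∞ :=
  if a = ∞ then ⨆ j, ENNReal.ofReal |lam j|
  else (∑' j, ENNReal.ofReal |lam j| ^ a.toReal) ^ (1 / a.toReal)

/-- The decreasing rearrangement of a sequence: `seqRearr lam j` is the
`(j+1)`-th largest value of `|lam i|`. -/
def seqRearr (lam : ℕ → ℝ) (j : ℕ) : ℝ≥0∞ :=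
  sInf {s : ℝ≥0∞ | Measure.count {i : ℕ | s < ENNReal.ofReal |lam i|} ≤ (j : ℝ≥0∞)}

/-- The Lorentz sequence norm `‖lam‖_{ℓ^{q,r}} = (Σ_j (j^{1/q} λ*_j)^r / j)^{1/r}`,
parametrized by `qinv = 1/q` and a finite second exponent `r`. -/
def seqLor (qinv r : ℝ) (lam : ℕ → ℝ) : ℝ≥0∞ :=
  (∑' j : ℕ, (((j : ℝ≥0∞) + 1) ^ qinv * seqRearr lam j) ^ r * ((j : ℝ≥0∞) + 1)⁻¹) ^ (1 / r)

/-- The interior of the triangle `OAB`, in the coordinates `(a, b) = (1/p, 1/q)`. -/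
def IntOAB (n : ℕ) (a b : ℝ) : Prop :=
  a ∈ Ioo (0 : ℝ) 1 ∧ b ∈ Ioo (0 : ℝ) 1 ∧ b < (n : ℝ) / (n - 1) * a ∧ 2 * b + n * a < n

/-- The interior of the quadrilateral `OCDA`, in the coordinates `(a, b) = (1/p, 1/q)`. -/
def IntOCDA (n : ℕ) (a b : ℝ) : Prop :=
  a ∈ Ioo (0 : ℝ) 1 ∧ b ∈ Ioo (0 : ℝ) 1 ∧ (n : ℝ) / (n - 1) * a < b ∧ 2 * b + n * a < n

def ptO : ℝ × ℝ := (0, 0)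
def ptA (n : ℕ) : ℝ × ℝ := (((n : ℝ) - 1) / (n + 1), (n : ℝ) / (n + 1))
def ptB : ℝ × ℝ := (1, 0)
def ptC : ℝ × ℝ := (0, 1)
def ptD (n : ℕ) : ℝ × ℝ := (((n : ℝ) - 2) / n, 1)

/-- The closed triangle `OAB`. -/
def OAB (n : ℕ) : Set (ℝ × ℝ) := convexHull ℝ {ptO, ptA n, ptB}

/-- The closed quadrilateral `OCDA`. -/
def OCDA (n : ℕ) : Set (ℝ × ℝ) := convexHull ℝ {ptO, ptC, ptD n, ptA n}

/-- The half-open segment `[A, D)`. -/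
def segAD (n : ℕ) : Set (ℝ × ℝ) := {x | ∃ t ∈ Ico (0 : ℝ) 1, x = (1 - t) • ptA n + t • ptD n}

/-- The Lebesgue exponent with reciprocal `a` (so `expOf 0 = ∞`). -/
def expOf (a : ℝ) : ℝ≥0∞ := (ENNReal.ofReal a)⁻¹

/-- The weighted velocity average `∫ f(x - tv, v) |v|^{-2s} dv` of the solution of
the kinetic transport equation with datum `f`. -/
def velAvg {n : ℕ} (s : ℝ) (f : Rn n × Rn n → ℂ) (t : ℝ) (x : Rn n) : ℂ :=
  ∫ v : Rn n, ((‖v‖ ^ (-(2 * s)) : ℝ) : ℂ) * f (x - t • v, v)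

end OS

open OS

open scoped FourierTransform in
lemma FT_eq_fourier {n : ℕ} (f : Rn n → ℂ) (ξ : Rn n) :
    FT f ξ = 𝓕 f ((2 * π)⁻¹ • ξ) := by
  rw [Real.fourier_eq', FT]
  congr 1 with x
  rw [smul_eq_mul]
  congr 2
  have : inner ℝ x ((2 * π)⁻¹ • ξ) = (2 * π)⁻¹ * ∑ i, x i * ξ i := by
    rw [inner_smul_right, PiLp.inner_apply]
    simp [mul_comm]
  rw [this, dotC, ← mul_assoc]
  have h2 : -2 * π * (2 * π)⁻¹ = -1 := by field_simp
  rw [h2]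
  push_cast
  ring

/-- The point of `ℝⁿ` with the given natural number coordinates. -/
def latticePt {n : ℕ} (m : Fin n → ℕ) : Rn n := WithLp.toLp 2 fun i => (m i : ℝ)

lemma one_le_dist_latticePt {n : ℕ} {j k : Fin n → ℕ} (h : j ≠ k) :
    1 ≤ dist (latticePt j) (latticePt k) := by
  obtain ⟨i, hi⟩ := Function.ne_iff.mp h
  rw [dist_eq_norm]
  refine le_trans ?_ (PiLp.norm_apply_le (latticePt j - latticePt k) i)
  have h1 : (1 : ℤ) ≤ |(j i : ℤ) - k i| := Int.one_le_abs (by omega)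
  rw [latticePt, latticePt, PiLp.sub_apply, Real.norm_eq_abs]
  have h2 : (1 : ℝ) ≤ |((j i : ℤ) : ℝ) - ((k i : ℤ) : ℝ)| := by exact_mod_cast h1
  simpa only [Int.cast_natCast] using h2

lemma norm_latticePt_le {n : ℕ} {m : Fin n → ℕ} {M : ℕ} (h : ∀ i, m i < M) :
    ‖latticePt m‖ ≤ n * M := by
  have h1 : latticePt m = ∑ i, (m i : ℝ) • EuclideanSpace.single i (1 : ℝ) := by
    ext k
    simp [latticePt, Finset.sum_apply, Pi.single_apply]
  rw [h1]
  calc _ ≤ ∑ i : Fin n, ‖(m i : ℝ) • EuclideanSpace.single i (1 : ℝ)‖ := norm_sum_le _ _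
    _ ≤ ∑ i : Fin n, (M : ℝ) := by
        refine Finset.sum_le_sum fun i _ => ?_
        rw [norm_smul]
        simpa using (h i).le
    _ = n * M := by simp

open scoped FourierTransform SchwartzMap in
/-- An orthonormal system whose Fourier transforms are disjoint translates of a bump. -/
lemma exists_orthonormal_FT_translates (n : ℕ) :
    ∃ (g : (Fin n → ℕ) → Rn n → ℂ) (χ : Rn n → ℝ),
      (∀ j k, (∫ x : Rn n, g j x * (starRingEnd ℂ) (g k x)) = if j = k then 1 else 0) ∧
      (∀ j ξ, FT (g j) ξ = (χ (ξ - (2 * π) • latticePt j) : ℂ)) ∧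
      (∀ ξ, 0 ≤ χ ξ) ∧ (∀ ξ, χ ξ ≠ 0 → ‖ξ‖ ≤ π) ∧ Integrable χ ∧ 0 < ∫ ξ, χ ξ := by
  let ψ : ContDiffBump (0 : Rn n) := ⟨1 / 4, 1 / 2, by norm_num, by norm_num⟩
  have hψc : Continuous ψ := ψ.continuous
  have hψ2 : 0 < ∫ x, ψ x ^ 2 := by
    have hc : HasCompactSupport fun x => ψ x ^ 2 :=
      ψ.hasCompactSupport.comp_left (g := fun y : ℝ => y ^ 2) (by norm_num)
    refine (hψc.pow 2).integral_pos_of_hasCompactSupport_nonneg_nonzero hc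
      (fun x => sq_nonneg _) (x := 0) ?_
    rw [ψ.one_of_mem_closedBall (by simp [ψ])]
    norm_num
  set κ : ℝ := (√(∫ x, ψ x ^ 2))⁻¹ with hκ
  have hκ0 : 0 < κ := by positivity
  have hκ2 : κ ^ 2 * ∫ x, ψ x ^ 2 = 1 := by
    rw [hκ, inv_pow, Real.sq_sqrt hψ2.le, inv_mul_cancel₀ hψ2.ne']
  have hcd (j : Fin n → ℕ) :
      ContDiff ℝ (⊤ : ℕ∞) fun η => ((κ * ψ (η - latticePt j) : ℝ) : ℂ) :=
    Complex.ofRealCLM.contDiff.comp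
      (contDiff_const.mul (ψ.contDiff.comp (contDiff_id.sub contDiff_const)))
  have hcs (j : Fin n → ℕ) :
      HasCompactSupport fun η => ((κ * ψ (η - latticePt j) : ℝ) : ℂ) := by
    have h1 : HasCompactSupport fun η => ψ (η - latticePt j) :=
      ψ.hasCompactSupport.comp_homeomorph (Homeomorph.subRight (latticePt j))
    exact h1.comp_left (g := fun y : ℝ => ((κ * y : ℝ) : ℂ)) (by simp)
  let φ (j : Fin n → ℕ) : 𝓢(Rn n, ℂ) := (hcs j).toSchwartzMap (hcd j)
  have hφ (j η) : φ j η = ((κ * ψ (η - latticePt j) : ℝ) : ℂ) := rfl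
  refine ⟨fun j => (𝓕⁻ (φ j) : 𝓢(Rn n, ℂ)), fun ξ => κ * ψ ((2 * π)⁻¹ • ξ), ?_, ?_, ?_, ?_, ?_, ?_⟩
  · intro j k
    have h := SchwartzMap.integral_inner_fourier_fourier (𝓕⁻ (φ k)) (𝓕⁻ (φ j))
    simp only [FourierTransform.fourier_fourierInv_eq] at h
    simp only [RCLike.inner_apply] at h
    rw [← h]
    simp only [hφ, Complex.conj_ofReal, ← Complex.ofReal_mul]
    split_ifs with hjk
    · subst hjk
      rw [integral_complex_ofReal,
        integral_sub_right_eq_self (fun η => κ * ψ η * (κ * ψ η)) (latticePt j)]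
      have : ∀ η, κ * ψ η * (κ * ψ η) = κ ^ 2 * ψ η ^ 2 := fun η => by ring
      simp only [this, integral_const_mul, hκ2, Complex.ofReal_one]
    · rw [integral_eq_zero_of_ae]
      refine Filter.Eventually.of_forall fun η => ?_
      have hd := one_le_dist_latticePt hjk
      by_cases h1 : 1 / 2 ≤ dist (η - latticePt j) 0
      · simp [ψ.zero_of_le_dist h1]
      · have h2 : 1 / 2 ≤ dist (η - latticePt k) 0 := by
          rw [dist_zero_right, ← dist_eq_norm] at h1 ⊢
          have := dist_triangle_left (latticePt j) (latticePt k) η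
          linarith
        simp [ψ.zero_of_le_dist h2]
  · intro j ξ
    rw [FT_eq_fourier, ← SchwartzMap.fourier_coe, FourierTransform.fourier_fourierInv_eq, hφ]
    beta_reduce
    rw [smul_sub, smul_smul, inv_mul_cancel₀ (by positivity), one_smul]
  · exact fun ξ => mul_nonneg hκ0.le ψ.nonneg
  · intro ξ h
    by_contra! hlt
    refine h ?_
    beta_reduce
    rw [ψ.zero_of_le_dist, mul_zero]
    rw [dist_zero_right, norm_smul, norm_inv, Real.norm_of_nonneg (by positivity)]
    change (1 / 2 : ℝ) ≤ _
    rw [inv_mul_eq_div, div_le_div_iff₀ (by norm_num) (by positivity)]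
    linarith
  · exact (ψ.integrable.comp_smul (R := (2 * π)⁻¹) (by positivity)).const_mul κ
  · rw [integral_const_mul, Measure.integral_comp_smul]
    have := ψ.integral_pos (μ := volume)
    positivity

/-- Without oscillation on the support of the amplitude there is no cancellation. -/
lemma integral_le_norm_integral_exp {E : Type*} [MeasurableSpace E] {μ : Measure E}
    {χ θ : E → ℝ} {c : ℝ} (hχ : Integrable χ μ) (h0 : ∀ ξ, 0 ≤ χ ξ) (hθ : AEStronglyMeasurable θ μ)
    (hc : ∀ ξ, χ ξ ≠ 0 → |θ ξ - c| ≤ 1) :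
    (1 / 2) * ∫ ξ, χ ξ ∂μ ≤ ‖∫ ξ, Complex.exp (Complex.I * θ ξ) * (χ ξ : ℂ) ∂μ‖ := by
  have hint : Integrable (fun ξ => Complex.exp (Complex.I * θ ξ) * (χ ξ : ℂ)) μ := by
    refine hχ.ofReal.bdd_mul (c := 1) ?_ (Filter.Eventually.of_forall fun ξ => ?_)
    · exact Complex.continuous_exp.comp_aestronglyMeasurable
        ((Complex.continuous_ofReal.comp_aestronglyMeasurable hθ).const_mul _)
    · rw [mul_comm, Complex.norm_exp_ofReal_mul_I]
  have hre (ξ : E) : (Complex.exp (-(c * Complex.I)) *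
      (Complex.exp (Complex.I * θ ξ) * (χ ξ : ℂ))).re = Real.cos (θ ξ - c) * χ ξ := by
    rw [← mul_assoc, ← Complex.exp_add, Complex.re_mul_ofReal]
    have : -(c * Complex.I) + Complex.I * θ ξ = ((θ ξ - c : ℝ) : ℂ) * Complex.I := by
      push_cast; ring
    rw [this, Complex.exp_ofReal_mul_I_re]
  calc (1 / 2) * ∫ ξ, χ ξ ∂μ = ∫ ξ, (1 / 2) * χ ξ ∂μ := (integral_const_mul _ _).symm
    _ ≤ ∫ ξ, (Complex.exp (-(c * Complex.I)) *
          (Complex.exp (Complex.I * θ ξ) * (χ ξ : ℂ))).re ∂μ := by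
        refine integral_mono (hχ.const_mul _) (hint.const_mul _).re fun ξ => ?_
        simp only [hre]
        by_cases h : χ ξ = 0
        · simp [h]
        · refine mul_le_mul_of_nonneg_right ?_ (h0 ξ)
          have h1 := Real.one_sub_sq_div_two_le_cos (x := θ ξ - c)
          have h2 : (θ ξ - c) ^ 2 ≤ 1 := (sq_le_one_iff_abs_le_one _).mpr (hc ξ h)
          linarith
    _ = (∫ ξ, Complex.exp (-(c * Complex.I)) *
          (Complex.exp (Complex.I * θ ξ) * (χ ξ : ℂ)) ∂μ).re := integral_re (hint.const_mul _)
    _ ≤ ‖∫ ξ, Complex.exp (-(c * Complex.I)) *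
          (Complex.exp (Complex.I * θ ξ) * (χ ξ : ℂ)) ∂μ‖ := Complex.re_le_norm _
    _ = _ := by
        rw [integral_const_mul, norm_mul, ← neg_mul, ← Complex.ofReal_neg,
          Complex.norm_exp_ofReal_mul_I, one_mul]

/-- A datum whose Fourier transform is a bump around `v` does not disperse as long as
`|t| ‖v‖` is small. -/
lemma le_norm_schrodinger {n : ℕ} {f : Rn n → ℂ} {χ : Rn n → ℝ} {v : Rn n}
    (hf : ∀ ξ, FT f ξ = (χ (ξ - v) : ℂ)) (h0 : ∀ ξ, 0 ≤ χ ξ)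
    (hsupp : ∀ ξ, χ ξ ≠ 0 → ‖ξ‖ ≤ π) (hχ : Integrable χ) {t : ℝ} {x : Rn n}
    (hsmall : ‖x‖ * π + |t| * (π * (π + 2 * ‖v‖)) ≤ 1) :
    (2 * π) ^ (-(n : ℝ)) * ((1 / 2) * ∫ ξ, χ ξ) ≤ ‖schrodinger f t x‖ := by
  have hdot (ξ : Rn n) : dotC x ξ = ((inner ℝ x ξ : ℝ) : ℂ) := by
    rw [dotC, PiLp.inner_apply]
    simp [mul_comm]
  have hs : schrodinger f t x = ((2 * π : ℝ) ^ (-(n : ℝ)) : ℝ) • ∫ ξ : Rn n,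
      Complex.exp (Complex.I * ((inner ℝ x ξ - t * ‖ξ‖ ^ 2 : ℝ) : ℂ)) * (χ (ξ - v) : ℂ) := by
    simp only [schrodinger, prop, one_mul, hf, hdot]
    push_cast
    rfl
  rw [hs, norm_smul, Real.norm_of_nonneg (by positivity), ← integral_sub_right_eq_self χ v]
  refine mul_le_mul_of_nonneg_left ?_ (by positivity)
  refine integral_le_norm_integral_exp (c := inner ℝ x v - t * ‖v‖ ^ 2) (hχ.comp_sub_right v)
    (fun ξ => h0 _) (by fun_prop) fun ξ hξ => ?_
  have hd := hsupp _ hξ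
  have e1 : (inner ℝ x ξ - t * ‖ξ‖ ^ 2) - (inner ℝ x v - t * ‖v‖ ^ 2)
      = inner ℝ x (ξ - v) - t * ((‖ξ‖ - ‖v‖) * (‖ξ‖ + ‖v‖)) := by
    rw [inner_sub_right]; ring
  have e2 : |inner ℝ x (ξ - v)| ≤ ‖x‖ * π :=
    (abs_real_inner_le_norm _ _).trans (by gcongr)
  have e3 : |‖ξ‖ - ‖v‖| ≤ π := (abs_norm_sub_norm_le _ _).trans hd
  have e4 : ‖ξ‖ + ‖v‖ ≤ π + 2 * ‖v‖ := by linarith [(abs_le.mp e3).2]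
  rw [e1]
  refine (abs_sub _ _).trans (le_trans (add_le_add e2 ?_) hsmall)
  rw [abs_mul, abs_mul, abs_of_nonneg (a := ‖ξ‖ + ‖v‖) (by positivity)]
  gcongr

lemma expOf_toReal {a : ℝ} (ha : 0 ≤ a) : 1 / (expOf a).toReal = a := by
  rw [expOf, ENNReal.toReal_inv, one_div, inv_inv, ENNReal.toReal_ofReal ha]

lemma le_eLp_expOf {β : Type*} [MeasurableSpace β] {μ : Measure β} {b : ℝ} (hb : 0 ≤ b)
    {F : β → ℝ≥0∞} {K : ℝ≥0∞} {T : Set β} (hT : MeasurableSet T) (hμT : μ T ≠ 0)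
    (hF : ∀ t ∈ T, K ≤ F t) : K * μ T ^ b ≤ eLp μ (expOf b) F := by
  rw [eLp]
  split_ifs with h
  · have hb0 : b = 0 := by
      rw [expOf, ENNReal.inv_eq_top, ENNReal.ofReal_eq_zero] at h
      exact le_antisymm h hb
    rw [hb0, ENNReal.rpow_zero, mul_one]
    by_contra! hlt
    refine hμT (measure_mono_null (fun t ht => ?_) (meas_essSup_lt (f := F) (μ := μ)))
    exact hlt.trans_le (hF t ht)
  · have hb0 : 0 < b := by
      rcases hb.lt_or_eq with h' | h'
      · exact h'
      · exact absurd (by simp [expOf, ← h']) h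
    have hq : (expOf b).toReal = b⁻¹ := by
      rw [expOf, ENNReal.toReal_inv, ENNReal.toReal_ofReal hb]
    rw [hq, one_div, inv_inv]
    calc K * μ T ^ b = (K ^ b⁻¹ * μ T) ^ b := by
          rw [ENNReal.mul_rpow_of_nonneg _ _ hb, ENNReal.rpow_inv_rpow hb0.ne']
      _ ≤ _ := by
          refine ENNReal.rpow_le_rpow ?_ hb
          rw [← setLIntegral_const]
          refine (setLIntegral_mono' hT fun t ht => ?_).trans (setLIntegral_le_lintegral T _)
          exact ENNReal.rpow_le_rpow (hF t ht) (by positivity)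

lemma le_eLpNorm_expOf {n : ℕ} {a : ℝ} (ha : 0 < a) {u : Rn n → ℝ} {K : ℝ} (hK : 0 ≤ K)
    {B : Set (Rn n)} (hB : MeasurableSet B) (hu : ∀ x ∈ B, K ≤ u x) :
    ENNReal.ofReal K * volume B ^ a ≤ eLpNorm u (expOf a) volume := by
  have h := eLpNorm_indicator_const (μ := (volume : Measure (Rn n))) (c := K) (p := expOf a) hB
    (by simp [expOf]) (by simpa [expOf] using ha)
  rw [expOf_toReal ha.le, Real.enorm_eq_ofReal hK] at h
  rw [← h]
  refine eLpNorm_mono fun x => ?_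
  by_cases hx : x ∈ B
  · rw [indicator_of_mem hx, Real.norm_of_nonneg hK]
    exact (hu x hx).trans (Real.le_norm_self _)
  · simp [indicator_of_notMem hx]

lemma seqNormE_indicator {α : ℝ} (hα : 0 < α) (S : Finset ℕ) :
    seqNormE (ENNReal.ofReal α) (fun j => if j ∈ S then 1 else 0) = (S.card : ℝ≥0∞) ^ (1 / α) := by
  rw [seqNormE, if_neg ENNReal.ofReal_ne_top, ENNReal.toReal_ofReal hα.le,
    tsum_eq_sum (s := S) (fun j hj => by simp [hj, hα])]
  congr 1
  rw [Finset.sum_congr rfl (g := fun _ => (1 : ℝ≥0∞)) (fun j hj => by simp [hj])]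
  simp

lemma card_mul_le_density {n : ℕ} {f : ℕ → Rn n → ℂ} {S : Finset ℕ} {t : ℝ} {x : Rn n} {δ : ℝ}
    (hδ : 0 ≤ δ) (h : ∀ j ∈ S, δ ≤ ‖schrodinger (f j) t x‖) :
    S.card * δ ^ 2 ≤ density (fun j => if j ∈ S then 1 else 0) f t x := by
  rw [density, density2, tsum_eq_sum (s := S) (fun j hj => by simp [hj]), ← nsmul_eq_mul]
  refine Finset.card_nsmul_le_sum _ _ _ fun j hj => ?_
  rw [if_pos hj, one_mul]
  have := h j hj
  gcongr

/-- Sharpness on `(A, B]`: for `α > 2p/(p+1)` the orthonormal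
Strichartz estimate fails.  Here `(a, b) = (1/p, 1/q)` and `2p/(p+1) = 2/(1+a)`. -/
theorem orthonormal_strichartz_AB_fails (n : ℕ) (hn : 1 ≤ n) (a b : ℝ)
    (hab : ∃ t ∈ Ioc (0 : ℝ) 1, (a, b) = (1 - t) • ptA n + t • ptB)
    (α : ℝ) (hα : 2 / (1 + a) < α) :
    ¬ ∃ C : ℝ, 0 < C ∧ ∀ (f : ℕ → Rn n → ℂ) (lam : ℕ → ℝ),
      OrthonormalL2 f → seqNormE (ENNReal.ofReal α) lam ≠ ∞ →
      mixedLp (expOf b) (expOf a) (density lam f)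
        ≤ ENNReal.ofReal C * seqNormE (ENNReal.ofReal α) lam := by
  rintro ⟨C, hC, H⟩
  obtain ⟨s, ⟨hs0, hs1⟩, hs⟩ := hab
  have hn' : (1 : ℝ) ≤ n := by exact_mod_cast hn
  have hae : a = (1 - s) * ((n - 1) / (n + 1)) + s := by
    simpa [ptA, ptB] using congrArg Prod.fst hs
  have hbe : b = (1 - s) * (n / (n + 1)) := by
    simpa [ptA, ptB] using congrArg Prod.snd hs
  have ha : 0 < a := by
    have : 0 ≤ (1 - s) * (((n : ℝ) - 1) / (n + 1)) :=
      mul_nonneg (by linarith) (div_nonneg (by linarith) (by linarith))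
    linarith
  have hb : 0 ≤ b := by
    rw [hbe]
    exact mul_nonneg (by linarith) (by positivity)
  have hline : 2 * b + n * a = n := by
    rw [hae, hbe]
    field_simp
    ring
  have hα0 : 0 < α := lt_trans (by positivity) hα
  have hexp : 0 < n - b - n * (1 / α) := by
    have h1 : 2 < α * (1 + a) := (div_lt_iff₀ (by linarith)).mp hα
    have h2 : n * (1 / α) < n * ((1 + a) / 2) := by
      refine mul_lt_mul_of_pos_left ?_ (by linarith)
      rw [div_lt_div_iff₀ hα0 (by norm_num)]
      linarith
    linarith
  obtain ⟨g, χ, hg, hFT, h0, hsupp, hχ, hpos⟩ := exists_orthonormal_FT_translates n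
  have : Nonempty (Fin n) := ⟨⟨0, hn⟩⟩
  obtain ⟨e⟩ : Nonempty (ℕ ≃ (Fin n → ℕ)) := nonempty_equiv_of_countable
  have hON : OrthonormalL2 fun j => g (e j) := by
    intro j k
    simpa using hg (e j) (e k)
  set δ : ℝ := (2 * π) ^ (-(n : ℝ)) * ((1 / 2) * ∫ ξ, χ ξ) with hδ
  have hδ0 : 0 < δ := by positivity
  set c : ℝ := (π + π * (π + 4 * π * n))⁻¹ with hc
  have hc0 : 0 < c := by positivity
  set V : ℝ := (volume (Metric.closedBall (0 : Rn n) c)).toReal with hV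
  have hVtop : volume (Metric.closedBall (0 : Rn n) c) ≠ ∞ :=
    measure_closedBall_lt_top.ne
  have hV0 : 0 < V := ENNReal.toReal_pos
    (Metric.measure_closedBall_pos volume _ hc0).ne' hVtop
  have key (M : ℕ) (hM : 1 ≤ M) :
      δ ^ 2 * V ^ a * c ^ b * (M : ℝ) ^ (n - b - n * (1 / α)) ≤ C := by
    have hM' : (1 : ℝ) ≤ M := by exact_mod_cast hM
    have hM0 : (0 : ℝ) < M := by linarith
    let S : Finset ℕ := (Fintype.piFinset fun _ : Fin n => Finset.range M).map e.symm.toEmbedding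
    have hScard : S.card = M ^ n := by simp [S]
    have hmem (j : ℕ) (hj : j ∈ S) (i : Fin n) : e j i < M := by
      simp only [S, Finset.mem_map_equiv, Equiv.symm_symm, Fintype.mem_piFinset,
        Finset.mem_range] at hj
      exact hj i
    have hdens (t : ℝ) (ht : t ∈ Icc 0 (c / M)) (x : Rn n) (hx : x ∈ Metric.closedBall 0 c) :
        (M : ℝ) ^ n * δ ^ 2 ≤ density (fun j => if j ∈ S then 1 else 0) (fun j => g (e j)) t x := by
      have := card_mul_le_density (f := fun j => g (e j)) (S := S) (t := t) (x := x) hδ0.le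
        fun j hj => le_norm_schrodinger (hFT (e j)) h0 hsupp hχ ?_
      · simpa [hScard] using this
      · have h1 : ‖(2 * π) • latticePt (e j)‖ ≤ 2 * π * (n * M) := by
          rw [norm_smul, Real.norm_of_nonneg (by positivity)]
          gcongr
          exact norm_latticePt_le (hmem j hj)
        rw [mem_closedBall_zero_iff] at hx
        rw [abs_of_nonneg ht.1]
        calc ‖x‖ * π + t * (π * (π + 2 * ‖(2 * π) • latticePt (e j)‖))
            ≤ c * π + c / M * (π * (π * M + 2 * (2 * π * (n * M)))) := by
              have := ht.2
              gcongr
              exact le_mul_of_one_le_right (by positivity) hM'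
          _ = c * (π + π * (π + 4 * π * n)) := by field_simp; ring
          _ = 1 := inv_mul_cancel₀ (by positivity)
          _ ≤ 1 := le_rfl
    have hvolT : (volume (Icc 0 (c / M)) : ℝ≥0∞) = ENNReal.ofReal (c / M) := by
      rw [Real.volume_Icc, sub_zero]
    have hlow : ENNReal.ofReal ((M : ℝ) ^ n * δ ^ 2) * volume (Metric.closedBall (0 : Rn n) c) ^ a *
        (volume (Icc 0 (c / M))) ^ b ≤ mixedLp (expOf b) (expOf a)
          (density (fun j => if j ∈ S then 1 else 0) (fun j => g (e j))) :=
      le_eLp_expOf hb measurableSet_Icc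
        (by rw [hvolT]; exact (ENNReal.ofReal_pos.mpr (by positivity)).ne')
        fun t ht => le_eLpNorm_expOf ha (by positivity) measurableSet_closedBall
          fun x hx => hdens t ht x hx
    have hseq := seqNormE_indicator hα0 S
    have hseq' : ((S.card : ℕ) : ℝ≥0∞) ^ (1 / α) = ENNReal.ofReal (((M : ℝ) ^ n) ^ (1 / α)) := by
      rw [hScard, ← ENNReal.ofReal_rpow_of_pos (by positivity), ← ENNReal.ofReal_natCast]
      push_cast
      rfl
    rw [hseq'] at hseq
    have hup := hlow.trans (H _ _ hON (by rw [hseq]; exact ENNReal.ofReal_ne_top))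
    rw [hseq, hvolT, ← ENNReal.ofReal_toReal hVtop, ← hV, ENNReal.ofReal_rpow_of_pos hV0,
      ENNReal.ofReal_rpow_of_pos (by positivity), ← ENNReal.ofReal_mul (by positivity),
      ← ENNReal.ofReal_mul (by positivity), ← ENNReal.ofReal_mul hC.le,
      ENNReal.ofReal_le_ofReal_iff (by positivity), Real.div_rpow hc0.le hM0.le,
      ← Real.rpow_natCast, ← Real.rpow_mul hM0.le] at hup
    rw [Real.rpow_sub hM0, Real.rpow_sub hM0]
    calc _ = ((M : ℝ) ^ (n : ℝ) * δ ^ 2 * V ^ a * (c ^ b / (M : ℝ) ^ b)) / (M : ℝ) ^ (n * (1 / α)) := by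
          ring
      _ ≤ C := (div_le_iff₀ (by positivity)).mpr hup
  have hD : 0 < δ ^ 2 * V ^ a * c ^ b := by positivity
  have hlim := ((tendsto_rpow_atTop hexp).comp tendsto_natCast_atTop_atTop).const_mul_atTop hD
  obtain ⟨M, hM1, hM⟩ :=
    ((Filter.eventually_ge_atTop 1).and (hlim.eventually_gt_atTop C)).exists
  exact absurd (key M hM1) (not_le.mpr hM)
end
end

section
/- Let n = 1. The estimate ‖ Σ_j λ_j |e^{it∂ₓ²}f_j|² ‖_{L^{2,∞}(ℝ, L^∞(ℝ))} ≤ C ‖{λ_j}‖_{ℓ^α}, with some finite constant C uniform over all families {f_j} of functions orthonormal in L²(ℝ) and all sequences {λ_j} ∈ ℓ^α, holds if and only if 1 ≤ α < 2. -/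
noncomputable section

open MeasureTheory ENNReal Real Set

open OS

/-- A bounded a.e. strongly measurable function on a finite measure space is integrable. -/
lemma integrable_of_norm_le {X G : Type*} [MeasurableSpace X] [NormedAddCommGroup G]
    {μ : Measure X} [IsFiniteMeasure μ] {h : X → G} (hm : AEStronglyMeasurable h μ) (c : ℝ)
    (hc : ∀ x, ‖h x‖ ≤ c) : Integrable h μ :=
  ⟨hm, HasFiniteIntegral.of_bounded (C := c) (Filter.Eventually.of_forall hc)⟩

section Duality

variable {H ι : Type*} [NormedAddCommGroup H] [InnerProductSpace ℂ H] [CompleteSpace H]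

/-- The Hilbert–Schmidt duality argument: the diagonal coefficients `a j = ∫ |⟪e t, F j⟫|² dν`
of an orthonormal family are controlled by a Schur bound near the diagonal and by a
Hilbert–Schmidt bound away from it. -/
lemma sum_sq_le_near_add_far {ν : Measure ℝ} [IsFiniteMeasure ν] {e : ℝ → H}
    (he : StronglyMeasurable e) {M : ℝ} (hM : ∀ t, ‖e t‖ ≤ M) {F : ι → H}
    (hF : Orthonormal ℂ F) (J : Finset ι) (δ A B : ℝ)
    (hA : ∀ t, ∫ s, (if |t - s| < δ then ‖inner ℂ (e t) (e s)‖ else 0) ∂ν ≤ A)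
    (hB : ∫ p, (if |p.1 - p.2| < δ then 0 else ‖inner ℂ (e p.1) (e p.2)‖ ^ 2) ∂(ν.prod ν) ≤ B) :
    ∑ j ∈ J, (∫ t, ‖inner ℂ (e t) (F j)‖ ^ 2 ∂ν) ^ 2
      ≤ 2 * A * ∑ j ∈ J, (∫ t, ‖inner ℂ (e t) (F j)‖ ^ 2 ∂ν) + B := by
  classical
  have hM0 : 0 ≤ M := (norm_nonneg _).trans (hM 0)
  set g : ι → ℝ → ℂ := fun j t => inner ℂ (e t) (F j) with hg
  have hgm : ∀ j, StronglyMeasurable (g j) := fun j => he.inner stronglyMeasurable_const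
  have hgb : ∀ j t, ‖g j t‖ ≤ M := fun j t => by
    refine (norm_inner_le_norm _ _).trans ?_
    rw [hF.1 j, mul_one]; exact hM t
  set κ : ℝ × ℝ → ℂ := fun p => inner ℂ (e p.1) (e p.2) with hκ
  have hκm : StronglyMeasurable κ :=
    (he.comp_measurable measurable_fst).inner (he.comp_measurable measurable_snd)
  have hκb : ∀ p, ‖κ p‖ ≤ M * M := fun p =>
    (norm_inner_le_norm _ _).trans (mul_le_mul (hM _) (hM _) (norm_nonneg _) hM0)
  have hgem : ∀ j, StronglyMeasurable fun t => g j t • e t := fun j => (hgm j).smul he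
  have hgei : ∀ j, Integrable (fun t => g j t • e t) ν := fun j =>
    integrable_of_norm_le (hgem j).aestronglyMeasurable (M * M) fun t => by
      rw [norm_smul]; exact mul_le_mul (hgb j t) (hM t) (norm_nonneg _) hM0
  set w : ι → H := fun j => ∫ t, g j t • e t ∂ν with hw
  set G : ι → ι → ℂ := fun j k => ∫ t, starRingEnd ℂ (g j t) * g k t ∂ν with hG
  have hwF : ∀ j k, inner ℂ (w j) (F k) = G j k := fun j k => by
    rw [← inner_conj_symm, hw, ← integral_inner (hgei j), ← integral_conj]
    refine integral_congr_ae (Filter.Eventually.of_forall fun t => ?_)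
    simp only [inner_conj_symm, inner_smul_left]
    rfl
  set Γ : ℝ × ℝ → ℂ := fun p => ∑ j ∈ J, starRingEnd ℂ (g j p.1) * g j p.2 with hΓ
  have hg1 : ∀ j, StronglyMeasurable fun p : ℝ × ℝ => g j p.1 := fun j =>
    (hgm j).comp_measurable measurable_fst
  have hg2 : ∀ j, StronglyMeasurable fun p : ℝ × ℝ => g j p.2 := fun j =>
    (hgm j).comp_measurable measurable_snd
  have hΓjm : ∀ j, StronglyMeasurable fun p : ℝ × ℝ => starRingEnd ℂ (g j p.1) * g j p.2 :=
    fun j => ((Complex.continuous_conj.comp_stronglyMeasurable (hg1 j))).mul (hg2 j)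
  have hΓjb : ∀ j (p : ℝ × ℝ), ‖starRingEnd ℂ (g j p.1) * g j p.2‖ ≤ M * M := fun j p => by
    rw [norm_mul, RCLike.norm_conj]
    exact mul_le_mul (hgb _ _) (hgb _ _) (norm_nonneg _) hM0
  have hΓm : StronglyMeasurable Γ := Finset.stronglyMeasurable_fun_sum _ fun j _ => hΓjm j
  have hΓb : ∀ p, ‖Γ p‖ ≤ J.card * (M * M) := fun p => by
    refine (norm_sum_le _ _).trans ((Finset.sum_le_card_nsmul _ _ _ fun j _ => hΓjb j p).trans ?_)
    rw [nsmul_eq_mul]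
  -- the trace of the squared operator
  have hQ1 : ∀ j, ((‖w j‖ ^ 2 : ℝ) : ℂ) =
      ∫ p, starRingEnd ℂ (g j p.1) * g j p.2 * κ p ∂(ν.prod ν) := fun j => by
    have hInt : Integrable (fun p : ℝ × ℝ => starRingEnd ℂ (g j p.1) * g j p.2 * κ p)
        (ν.prod ν) :=
      integrable_of_norm_le ((hΓjm j).mul hκm).aestronglyMeasurable (M * M * (M * M)) fun p => by
        rw [norm_mul]
        exact mul_le_mul (hΓjb j p) (hκb p) (norm_nonneg _) (by positivity)
    rw [integral_prod _ hInt, Complex.ofReal_pow, ← Complex.coe_algebraMap,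
      ← inner_self_eq_norm_sq_to_K (𝕜 := ℂ)]
    have h1 : inner ℂ (w j) (w j) = ∫ t, inner ℂ (g j t • e t) (w j) ∂ν := by
      rw [← inner_conj_symm]
      conv_lhs => rw [hw]
      simp only
      rw [← integral_inner (hgei j), ← integral_conj]
      simp only [inner_conj_symm]
      rfl
    rw [h1]
    refine integral_congr_ae (Filter.Eventually.of_forall fun t => ?_)
    simp only
    rw [hw]
    simp only
    rw [← integral_inner (hgei j)]
    refine integral_congr_ae (Filter.Eventually.of_forall fun s => ?_)
    simp only [inner_smul_left, inner_smul_right, hκ]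
    ring
  set Q : ℝ := ∑ j ∈ J, ‖w j‖ ^ 2 with hQ
  have hQ2 : (Q : ℂ) = ∫ p, Γ p * κ p ∂(ν.prod ν) := by
    rw [hQ, Complex.ofReal_sum, Finset.sum_congr rfl fun j _ => hQ1 j, ← integral_finsetSum]
    · simp only [hΓ, Finset.sum_mul]
    · intro j _
      exact integrable_of_norm_le ((hΓjm j).mul hκm).aestronglyMeasurable (M * M * (M * M))
        fun p => by
          rw [norm_mul]
          exact mul_le_mul (hΓjb j p) (hκb p) (norm_nonneg _) (by positivity)
  have hS : ∫ p, ‖Γ p‖ ^ 2 ∂(ν.prod ν) = ∑ j ∈ J, ∑ k ∈ J, ‖G j k‖ ^ 2 := by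
    have key : ((∫ p, ‖Γ p‖ ^ 2 ∂(ν.prod ν) : ℝ) : ℂ) =
        ((∑ j ∈ J, ∑ k ∈ J, ‖G j k‖ ^ 2 : ℝ) : ℂ) := by
      rw [← integral_complex_ofReal]
      have h1 : ∀ p : ℝ × ℝ, ((‖Γ p‖ ^ 2 : ℝ) : ℂ) = ∑ j ∈ J, ∑ k ∈ J,
          (starRingEnd ℂ (g j p.1) * g k p.1) * (g j p.2 * starRingEnd ℂ (g k p.2)) := fun p => by
        rw [Complex.ofReal_pow, ← Complex.mul_conj', hΓ]
        simp only [map_sum, map_mul, Complex.conj_conj, Finset.sum_mul_sum]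
        refine Finset.sum_congr rfl fun j _ => Finset.sum_congr rfl fun k _ => ?_
        ring
      simp_rw [h1]
      have hInt : ∀ j k, Integrable (fun p : ℝ × ℝ =>
          (starRingEnd ℂ (g j p.1) * g k p.1) * (g j p.2 * starRingEnd ℂ (g k p.2)))
          (ν.prod ν) := fun j k =>
        integrable_of_norm_le
          ((((Complex.continuous_conj.comp_stronglyMeasurable (hg1 j))).mul (hg1 k)).mul
            ((hg2 j).mul (Complex.continuous_conj.comp_stronglyMeasurable
              (hg2 k)))).aestronglyMeasurable (M * M * (M * M)) fun p => by
          rw [norm_mul, norm_mul, norm_mul, RCLike.norm_conj, RCLike.norm_conj]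
          exact mul_le_mul (mul_le_mul (hgb _ _) (hgb _ _) (norm_nonneg _) hM0)
            (mul_le_mul (hgb _ _) (hgb _ _) (norm_nonneg _) hM0) (by positivity) (by positivity)
      rw [integral_finsetSum _ fun j _ => integrable_finsetSum _ fun k _ => hInt j k,
        Complex.ofReal_sum]
      refine Finset.sum_congr rfl fun j _ => ?_
      rw [integral_finsetSum _ fun k _ => hInt j k, Complex.ofReal_sum]
      refine Finset.sum_congr rfl fun k _ => ?_
      rw [integral_prod_mul (fun t => starRingEnd ℂ (g j t) * g k t)
        (fun t => g j t * starRingEnd ℂ (g k t)), Complex.ofReal_pow, ← Complex.mul_conj', hG]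
      simp only
      rw [← integral_conj]
      simp
    exact_mod_cast key
  have hSQ : ∑ j ∈ J, ∑ k ∈ J, ‖G j k‖ ^ 2 ≤ Q := by
    refine Finset.sum_le_sum fun j _ => ?_
    have := hF.sum_inner_products_le (w j) (s := J)
    refine le_trans (le_of_eq (Finset.sum_congr rfl fun k _ => ?_)) this
    rw [← hwF, norm_inner_symm]
  set a : ι → ℝ := fun j => ∫ t, ‖g j t‖ ^ 2 ∂ν with ha
  have haG : ∀ j, (a j) ^ 2 = ‖G j j‖ ^ 2 := fun j => by
    have : G j j = ((a j : ℝ) : ℂ) := by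
      rw [hG, ha]
      simp only
      rw [← integral_complex_ofReal]
      refine integral_congr_ae (Filter.Eventually.of_forall fun t => ?_)
      simp only [Complex.conj_mul', Complex.ofReal_pow]
    rw [this, Complex.norm_real, Real.norm_eq_abs, sq_abs]
  have haS : ∑ j ∈ J, (a j) ^ 2 ≤ ∑ j ∈ J, ∑ k ∈ J, ‖G j k‖ ^ 2 := by
    refine Finset.sum_le_sum fun j hj => ?_
    rw [haG]
    exact Finset.single_le_sum (f := fun k => ‖G j k‖ ^ 2) (fun k _ => sq_nonneg _) hj
  -- near and far parts
  have hDm : MeasurableSet {p : ℝ × ℝ | |p.1 - p.2| < δ} :=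
    (isOpen_lt (by fun_prop) continuous_const).measurableSet
  set kn : ℝ × ℝ → ℝ := fun p => if |p.1 - p.2| < δ then ‖κ p‖ else 0 with hkn
  set kf : ℝ × ℝ → ℝ := fun p => if |p.1 - p.2| < δ then 0 else ‖κ p‖ ^ 2 with hkf
  have hknm : StronglyMeasurable kn := StronglyMeasurable.ite hDm hκm.norm stronglyMeasurable_const
  have hkfm : StronglyMeasurable kf :=
    StronglyMeasurable.ite hDm stronglyMeasurable_const (hκm.norm.pow 2)
  have hkn0 : ∀ p, 0 ≤ kn p := fun p => by simp only [hkn]; split_ifs <;> positivity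
  have hknb : ∀ p, kn p ≤ M * M := fun p => by
    simp only [hkn]; split_ifs
    · exact hκb p
    · positivity
  have hkf0 : ∀ p, 0 ≤ kf p := fun p => by simp only [hkf]; split_ifs <;> positivity
  have hkfb : ∀ p, kf p ≤ (M * M) ^ 2 := fun p => by
    simp only [hkf]; split_ifs
    · positivity
    · exact pow_le_pow_left₀ (norm_nonneg _) (hκb p) 2
  set n1 : ι → ℝ × ℝ → ℝ := fun j p => kn p * ‖g j p.1‖ ^ 2 with hn1
  set n2 : ι → ℝ × ℝ → ℝ := fun j p => kn p * ‖g j p.2‖ ^ 2 with hn2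
  have hn1i : ∀ j, Integrable (n1 j) (ν.prod ν) := fun j =>
    integrable_of_norm_le (hknm.mul ((hg1 j).norm.pow 2)).aestronglyMeasurable (M * M * M ^ 2)
      fun p => by
        rw [Real.norm_eq_abs, abs_of_nonneg (mul_nonneg (hkn0 p) (sq_nonneg _))]
        exact mul_le_mul (hknb p) (pow_le_pow_left₀ (norm_nonneg _) (hgb _ _) 2) (sq_nonneg _)
          (by positivity)
  have hn2i : ∀ j, Integrable (n2 j) (ν.prod ν) := fun j =>
    integrable_of_norm_le (hknm.mul ((hg2 j).norm.pow 2)).aestronglyMeasurable (M * M * M ^ 2)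
      fun p => by
        rw [Real.norm_eq_abs, abs_of_nonneg (mul_nonneg (hkn0 p) (sq_nonneg _))]
        exact mul_le_mul (hknb p) (pow_le_pow_left₀ (norm_nonneg _) (hgb _ _) 2) (sq_nonneg _)
          (by positivity)
  have hn1A : ∀ j, ∫ p, n1 j p ∂(ν.prod ν) ≤ A * a j := fun j => by
    rw [integral_prod _ (hn1i j), ha]
    simp only
    rw [← integral_const_mul]
    refine integral_mono (hn1i j).integral_prod_left ?_ fun t => ?_
    · refine (integrable_of_norm_le ((hgm j).norm.pow 2).aestronglyMeasurable (M ^ 2)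
        fun t => ?_).const_mul A
      rw [Pi.pow_apply, norm_pow, norm_norm]
      exact pow_le_pow_left₀ (norm_nonneg _) (hgb _ _) 2
    · simp only [hn1]
      rw [integral_mul_const]
      exact mul_le_mul_of_nonneg_right (hA t) (sq_nonneg _)
  have hn12 : ∀ j, ∫ p, n2 j p ∂(ν.prod ν) = ∫ p, n1 j p ∂(ν.prod ν) := fun j => by
    rw [← integral_prod_swap]
    refine integral_congr_ae (Filter.Eventually.of_forall fun p => ?_)
    simp only [hn1, hn2, hkn, hκ, Prod.fst_swap, Prod.snd_swap, abs_sub_comm p.2 p.1,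
      norm_inner_symm (e p.2) (e p.1)]
  have hkfi : Integrable kf (ν.prod ν) :=
    integrable_of_norm_le hkfm.aestronglyMeasurable ((M * M) ^ 2) fun p => by
      rw [Real.norm_eq_abs, abs_of_nonneg (hkf0 p)]; exact hkfb p
  have hΓi : Integrable (fun p => ‖Γ p‖ ^ 2) (ν.prod ν) :=
    integrable_of_norm_le (hΓm.norm.pow 2).aestronglyMeasurable ((J.card * (M * M)) ^ 2)
      fun p => by
        rw [norm_pow, norm_norm]
        exact pow_le_pow_left₀ (norm_nonneg _) (hΓb p) 2
  have hpt : ∀ p, ‖Γ p * κ p‖ ≤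
      ∑ j ∈ J, (1 / 2 * n1 j p + 1 / 2 * n2 j p) + (1 / 2 * ‖Γ p‖ ^ 2 + 1 / 2 * kf p) := fun p => by
    rw [norm_mul]
    by_cases h : |p.1 - p.2| < δ
    · have e1 : kn p = ‖κ p‖ := if_pos h
      have h2 : ‖Γ p‖ * ‖κ p‖ ≤ ∑ j ∈ J, (1 / 2 * n1 j p + 1 / 2 * n2 j p) := by
        refine (mul_le_mul_of_nonneg_right (norm_sum_le _ _) (norm_nonneg _)).trans ?_
        rw [Finset.sum_mul]
        refine Finset.sum_le_sum fun j _ => ?_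
        simp only [hn1, hn2, e1]
        rw [norm_mul, RCLike.norm_conj]
        nlinarith [norm_nonneg (κ p), mul_nonneg (norm_nonneg (κ p))
          (sq_nonneg (‖g j p.1‖ - ‖g j p.2‖))]
      have := hkf0 p
      nlinarith [sq_nonneg ‖Γ p‖]
    · have e1 : kf p = ‖κ p‖ ^ 2 := if_neg h
      have h2 : 0 ≤ ∑ j ∈ J, (1 / 2 * n1 j p + 1 / 2 * n2 j p) :=
        Finset.sum_nonneg fun j _ => by
          have := mul_nonneg (hkn0 p) (sq_nonneg ‖g j p.1‖)
          have := mul_nonneg (hkn0 p) (sq_nonneg ‖g j p.2‖)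
          simp only [hn1, hn2]; linarith
      rw [e1]
      nlinarith [sq_nonneg (‖Γ p‖ - ‖κ p‖)]
  have hfin : Q ≤ A * ∑ j ∈ J, a j + (1 / 2 * Q + 1 / 2 * B) := by
    have hsi : ∀ j ∈ J, Integrable (fun p => 1 / 2 * n1 j p + 1 / 2 * n2 j p) (ν.prod ν) :=
      fun j _ => ((hn1i j).const_mul _).add ((hn2i j).const_mul _)
    have hti : Integrable (fun p => 1 / 2 * ‖Γ p‖ ^ 2 + 1 / 2 * kf p) (ν.prod ν) :=
      (hΓi.const_mul _).add (hkfi.const_mul _)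
    have h1 : Q ≤ ∫ p, ‖Γ p * κ p‖ ∂(ν.prod ν) := by
      calc Q ≤ ‖(Q : ℂ)‖ := by rw [Complex.norm_real]; exact le_abs_self _
        _ ≤ _ := by rw [hQ2]; exact norm_integral_le_integral_norm _
    refine h1.trans ((integral_mono_of_nonneg (Filter.Eventually.of_forall fun p => norm_nonneg _)
      ((integrable_finsetSum _ hsi).add hti) (Filter.Eventually.of_forall hpt)).trans ?_)
    simp only [Pi.add_apply]
    rw [integral_add (integrable_finsetSum _ hsi) hti, integral_finsetSum _ hsi,
      integral_add (hΓi.const_mul _) (hkfi.const_mul _), integral_const_mul, integral_const_mul,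
      hS, Finset.mul_sum J a A]
    refine add_le_add (Finset.sum_le_sum fun j _ => ?_) (by linarith)
    rw [integral_add ((hn1i j).const_mul _) ((hn2i j).const_mul _), integral_const_mul,
      integral_const_mul, hn12]
    linarith [hn1A j]
  have : ∑ j ∈ J, a j ^ 2 ≤ 2 * A * ∑ j ∈ J, a j + B := by linarith
  exact this

end Duality

section Kernel

lemma integral_truncated_abs_rpow {r R : ℝ} (hr : -1 < r) (hR : 0 < R) (t : ℝ) :
    ∫ s, (if |t - s| < R then |t - s| ^ r else 0) = 2 * (R ^ (r + 1) / (r + 1)) := by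
  rw [integral_sub_left_eq_self (fun u : ℝ => if |u| < R then |u| ^ r else 0) volume t,
    integral_comp_abs (f := fun u : ℝ => if u < R then u ^ r else 0)]
  congr 1
  have h1 : ∀ u : ℝ, (if u < R then u ^ r else 0) = (Iio R).indicator (fun u => u ^ r) u :=
    fun u => rfl
  simp_rw [h1]
  rw [setIntegral_indicator measurableSet_Iio, Ioi_inter_Iio, ← integral_Ioc_eq_integral_Ioo,
    ← intervalIntegral.integral_of_le hR.le, integral_rpow (Or.inl hr),
    Real.zero_rpow (by linarith), sub_zero]

lemma integrable_truncated_abs_rpow {r R : ℝ} (hr : -1 < r) (hR : 0 < R) (t : ℝ) :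
    Integrable fun s : ℝ => if |t - s| < R then |t - s| ^ r else 0 := by
  by_contra h
  have h1 := integral_undef h
  rw [integral_truncated_abs_rpow hr hR] at h1
  have : 0 < R ^ (r + 1) / (r + 1) := div_pos (Real.rpow_pos_of_pos hR _) (by linarith)
  linarith

variable {H ι : Type*} [NormedAddCommGroup H] [InnerProductSpace ℂ H]

lemma integral_near_le {E : Set ℝ} {e : ℝ → H}
    (hκ : ∀ t s, t ≠ s → ‖inner ℂ (e t) (e s)‖ ≤ |t - s| ^ (-(1 / 2) : ℝ)) {δ : ℝ} (hδ : 0 < δ)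
    (t : ℝ) :
    ∫ s in E, (if |t - s| < δ then ‖inner ℂ (e t) (e s)‖ else 0) ≤ 4 * √δ := by
  have hi := integrable_truncated_abs_rpow (r := -(1 / 2)) (by norm_num) hδ t
  have h0 : ∀ s, 0 ≤ (if |t - s| < δ then |t - s| ^ (-(1 / 2) : ℝ) else 0) := fun s => by
    split_ifs <;> positivity
  calc _ ≤ ∫ s in E, (if |t - s| < δ then |t - s| ^ (-(1 / 2) : ℝ) else 0) := by
        refine integral_mono_of_nonneg (Filter.Eventually.of_forall fun s => ?_)
          hi.integrableOn ?_
        · simp only [Pi.zero_apply]; split_ifs <;> positivity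
        · filter_upwards [Measure.ae_ne (volume.restrict E) t] with s hs
          split_ifs
          · exact hκ t s (Ne.symm hs)
          · exact le_rfl
    _ ≤ ∫ s, (if |t - s| < δ then |t - s| ^ (-(1 / 2) : ℝ) else 0) :=
        setIntegral_le_integral hi (Filter.Eventually.of_forall h0)
    _ = 4 * √δ := by
        rw [integral_truncated_abs_rpow (by norm_num) hδ, Real.sqrt_eq_rpow]
        norm_num
        ring

lemma integral_far_le {E : Set ℝ} (hE : volume E ≠ ∞) (hE0 : 0 < volume.real E) {e : ℝ → H}
    (he : StronglyMeasurable e) {M : ℝ} (hM : ∀ t, ‖e t‖ ≤ M)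
    (hκ : ∀ t s, t ≠ s → ‖inner ℂ (e t) (e s)‖ ≤ |t - s| ^ (-(1 / 2) : ℝ)) {δ θ : ℝ} (hδ : 0 < δ)
    (hθ : 0 < θ) (hθ1 : θ < 1) :
    ∫ p, (if |p.1 - p.2| < δ then 0 else ‖inner ℂ (e p.1) (e p.2)‖ ^ 2)
        ∂((volume.restrict E).prod (volume.restrict E))
      ≤ δ ^ (-θ) * (2 / θ + 1) * volume.real E ^ (1 + θ) := by
  have : IsFiniteMeasure (volume.restrict E) := ⟨by simpa using hE.lt_top⟩
  have hM0 : 0 ≤ M := (norm_nonneg _).trans (hM 0)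
  set L := volume.real E with hL
  have hDm : MeasurableSet {p : ℝ × ℝ | |p.1 - p.2| < δ} :=
    (isOpen_lt (by fun_prop) continuous_const).measurableSet
  have hκm : StronglyMeasurable fun p : ℝ × ℝ => inner ℂ (e p.1) (e p.2) :=
    (he.comp_measurable measurable_fst).inner (he.comp_measurable measurable_snd)
  have hi : Integrable (fun p : ℝ × ℝ =>
      if |p.1 - p.2| < δ then 0 else ‖inner ℂ (e p.1) (e p.2)‖ ^ 2)
      ((volume.restrict E).prod (volume.restrict E)) := by
    refine integrable_of_norm_le (StronglyMeasurable.ite hDm stronglyMeasurable_const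
      (hκm.norm.pow 2)).aestronglyMeasurable ((M * M) ^ 2) fun p => ?_
    split_ifs
    · simp only [norm_zero]; positivity
    · rw [norm_pow, norm_norm]
      exact pow_le_pow_left₀ (norm_nonneg _) ((norm_inner_le_norm _ _).trans
        (mul_le_mul (hM _) (hM _) (norm_nonneg _) hM0)) 2
  have hpt : ∀ t s, (if |t - s| < δ then 0 else ‖inner ℂ (e t) (e s)‖ ^ 2) ≤
      δ ^ (-θ) * ((if |t - s| < L then |t - s| ^ (θ - 1) else 0) + L ^ (θ - 1)) := fun t s => by
    have hL0 : 0 ≤ L ^ (θ - 1) := by positivity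
    rcases lt_or_ge |t - s| δ with h | h
    · rw [if_pos h]
      split_ifs <;> positivity
    · rw [if_neg (not_lt.2 h)]
      have hτ : 0 < |t - s| := hδ.trans_le h
      have h1 : ‖inner ℂ (e t) (e s)‖ ^ 2 ≤ |t - s| ^ (-1 : ℝ) := by
        refine (pow_le_pow_left₀ (norm_nonneg _) (hκ t s ?_) 2).trans (le_of_eq ?_)
        · rintro rfl; simp at hτ
        · rw [← Real.rpow_natCast, ← Real.rpow_mul hτ.le]; norm_num
      have h2 : |t - s| ^ (-1 : ℝ) = |t - s| ^ (-θ) * |t - s| ^ (θ - 1) := by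
        rw [← Real.rpow_add hτ]; congr 1; ring
      have h3 : |t - s| ^ (-θ) ≤ δ ^ (-θ) := Real.rpow_le_rpow_of_nonpos hδ h (by linarith)
      rw [h2] at h1
      refine h1.trans (mul_le_mul h3 ?_ (by positivity) (by positivity))
      split_ifs with h4
      · linarith
      · rw [zero_add]
        exact Real.rpow_le_rpow_of_nonpos hE0 (not_lt.1 h4) (by linarith)
  have hinner : ∀ t, ∫ s in E, (if |t - s| < δ then 0 else ‖inner ℂ (e t) (e s)‖ ^ 2) ≤
      δ ^ (-θ) * (2 / θ + 1) * L ^ θ := fun t => by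
    have hi1 := integrable_truncated_abs_rpow (r := θ - 1) (by linarith) hE0 t
    have hi2 : IntegrableOn (fun _ : ℝ => L ^ (θ - 1)) E := integrable_const _
    calc _ ≤ ∫ s in E, δ ^ (-θ) *
          ((if |t - s| < L then |t - s| ^ (θ - 1) else 0) + L ^ (θ - 1)) :=
          integral_mono_of_nonneg (Filter.Eventually.of_forall fun s => by
            simp only [Pi.zero_apply]; split_ifs <;> positivity)
            ((hi1.integrableOn.add hi2).const_mul _) (Filter.Eventually.of_forall (hpt t))
      _ = δ ^ (-θ) * ((∫ s in E, (if |t - s| < L then |t - s| ^ (θ - 1) else 0))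
            + L * L ^ (θ - 1)) := by
          rw [integral_const_mul, integral_add hi1.integrableOn hi2, setIntegral_const,
            smul_eq_mul]
      _ ≤ δ ^ (-θ) * (2 * (L ^ θ / θ) + L ^ θ) := by
          refine mul_le_mul_of_nonneg_left (add_le_add ?_ (le_of_eq ?_)) (by positivity)
          · refine (setIntegral_le_integral hi1 (Filter.Eventually.of_forall fun s => ?_)).trans
              (le_of_eq ?_)
            · simp only [Pi.zero_apply]; split_ifs <;> positivity
            · rw [integral_truncated_abs_rpow (by linarith) hE0]; simp
          · rw [← Real.rpow_one_add' hE0.le (by linarith)]; congr 1; ring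
      _ = _ := by ring
  rw [integral_prod _ hi]
  refine (integral_mono hi.integral_prod_left (integrable_const _) hinner).trans (le_of_eq ?_)
  rw [setIntegral_const, smul_eq_mul, Real.rpow_add hE0, Real.rpow_one]
  ring

variable [CompleteSpace H]

/-- Distributional estimate for the diagonal coefficients of an orthonormal family. -/
lemma card_mul_rpow_le {E : Set ℝ} (hE : volume E ≠ ∞) (hE0 : 0 < volume.real E) {e : ℝ → H}
    (he : StronglyMeasurable e) {M : ℝ} (hM : ∀ t, ‖e t‖ ≤ M)
    (hκ : ∀ t s, t ≠ s → ‖inner ℂ (e t) (e s)‖ ≤ |t - s| ^ (-(1 / 2) : ℝ)) {θ : ℝ}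
    (hθ : 0 < θ) (hθ1 : θ < 1) {F : ι → H} (hF : Orthonormal ℂ F) (J : Finset ι) {σ : ℝ}
    (hσ : 0 < σ) (hJ : ∀ j ∈ J, σ ≤ ∫ t in E, ‖inner ℂ (e t) (F j)‖ ^ 2) :
    J.card * σ ^ (2 * (1 + θ)) ≤
      2 * 256 ^ θ * (2 / θ + 1) * volume.real E ^ (1 + θ) := by
  have : IsFiniteMeasure (volume.restrict E) := ⟨by simpa using hE.lt_top⟩
  set a : ι → ℝ := fun j => ∫ t in E, ‖inner ℂ (e t) (F j)‖ ^ 2 with ha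
  have hδ : 0 < σ ^ 2 / 256 := by positivity
  have hmain := sum_sq_le_near_add_far (ν := volume.restrict E) he hM hF J (σ ^ 2 / 256) _ _
    (integral_near_le hκ hδ) (integral_far_le hE hE0 he hM hκ hδ hθ hθ1)
  have hsq : √(σ ^ 2 / 256) = σ / 16 := by
    rw [show σ ^ 2 / 256 = (σ / 16) ^ 2 by ring, Real.sqrt_sq (by positivity)]
  rw [hsq] at hmain
  set B := (σ ^ 2 / 256) ^ (-θ) * (2 / θ + 1) * volume.real E ^ (1 + θ) with hB
  have h1 : σ * ∑ j ∈ J, a j ≤ ∑ j ∈ J, a j ^ 2 := by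
    rw [Finset.mul_sum]
    refine Finset.sum_le_sum fun j hj => ?_
    have : σ ≤ a j := hJ j hj
    nlinarith
  have h2 : J.card * σ ^ 2 ≤ ∑ j ∈ J, a j ^ 2 := by
    rw [← nsmul_eq_mul]
    exact Finset.card_nsmul_le_sum _ _ _ fun j hj => pow_le_pow_left₀ hσ.le (hJ j hj) 2
  have h3 : J.card * σ ^ 2 ≤ 2 * B := by
    change ∑ j ∈ J, a j ^ 2 ≤ 2 * (4 * (σ / 16)) * ∑ j ∈ J, a j + B at hmain
    linarith
  have h4 : σ ^ (2 * (1 + θ)) = σ ^ 2 * (σ ^ 2) ^ θ := by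
    rw [← Real.rpow_natCast, ← Real.rpow_mul hσ.le, ← Real.rpow_add hσ]
    congr 1; push_cast; ring
  have h5 : (σ ^ 2 / 256) ^ (-θ) * (σ ^ 2) ^ θ = 256 ^ θ := by
    rw [Real.rpow_neg hδ.le, Real.div_rpow (by positivity) (by norm_num)]
    have : 0 < (σ ^ 2) ^ θ := by positivity
    field_simp
  calc J.card * σ ^ (2 * (1 + θ)) = J.card * σ ^ 2 * (σ ^ 2) ^ θ := by rw [h4]; ring
    _ ≤ 2 * B * (σ ^ 2) ^ θ := mul_le_mul_of_nonneg_right h3 (by positivity)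
    _ = 2 * ((σ ^ 2 / 256) ^ (-θ) * (σ ^ 2) ^ θ) * (2 / θ + 1) * volume.real E ^ (1 + θ) := by
        rw [hB]; ring
    _ = _ := by rw [h5]

end Kernel

/-- A weak-type `ℓ^p` bound on finite sums implies a strong `ℓ^β` bound for `β > p`. -/
lemma sum_rpow_le_of_card_mul_rpow_le {ι : Type*} {a : ι → ℝ} (ha : ∀ j, 0 ≤ a j) {D p β : ℝ}
    (hD : 0 ≤ D) (hp : 0 < p) (hβ : p < β)
    (h : ∀ (J : Finset ι) (σ : ℝ), 0 < σ → (∀ j ∈ J, σ ≤ a j) → J.card * σ ^ p ≤ D)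
    (J : Finset ι) :
    ∑ j ∈ J, a j ^ β ≤ D ^ (β / p) * ∑' m : ℕ, (((m : ℝ) + 1) ^ (β / p))⁻¹ := by
  classical
  have hβp : 1 < β / p := (one_lt_div hp).2 hβ
  have hsum : Summable fun m : ℕ => (((m : ℝ) + 1) ^ (β / p))⁻¹ := by
    have := (summable_nat_add_iff 1).2 (Real.summable_nat_rpow_inv.2 hβp)
    simpa using this
  have key : ∑ j ∈ J, a j ^ β ≤
      D ^ (β / p) * ∑ m ∈ Finset.range J.card, (((m : ℝ) + 1) ^ (β / p))⁻¹ := by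
    induction J using Finset.induction_on_min_value a with
    | empty => simp
    | insert i s hi hmin ih =>
      rw [Finset.sum_insert hi, Finset.card_insert_of_notMem hi, Finset.sum_range_succ, mul_add,
        add_comm]
      refine add_le_add ih ?_
      rcases (ha i).eq_or_lt with h0 | h0
      · rw [← h0, Real.zero_rpow (by linarith)]; positivity
      · have h1 := h (insert i s) (a i) h0 fun j hj => by
          rcases Finset.mem_insert.1 hj with rfl | hj
          · exact le_rfl
          · exact hmin j hj
        rw [Finset.card_insert_of_notMem hi] at h1
        push_cast at h1
        have hs : (0 : ℝ) < s.card + 1 := by positivity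
        have h2 : a i ^ p ≤ D / (s.card + 1) := by
          rw [le_div_iff₀ hs]; linarith
        calc a i ^ β = (a i ^ p) ^ (β / p) := by
              rw [← Real.rpow_mul h0.le]; congr 1; field_simp
          _ ≤ (D / (s.card + 1)) ^ (β / p) :=
              Real.rpow_le_rpow (by positivity) h2 (by positivity)
          _ = _ := by rw [Real.div_rpow hD hs.le, div_eq_mul_inv]
  refine key.trans (mul_le_mul_of_nonneg_left ?_ (by positivity))
  exact hsum.sum_le_tsum _ fun m _ => by positivity

/-- The dual form of the endpoint estimate: a Schatten-type bound for kernels of size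
`|t - s|^{-1/2}` restricted to a set of finite measure. -/
lemma exists_sum_mul_integral_le (H : Type*) [NormedAddCommGroup H] [InnerProductSpace ℂ H]
    [CompleteSpace H] {α : ℝ} (hα : 1 ≤ α) (hα2 : α < 2) :
    ∃ C : ℝ, 0 < C ∧ ∀ (ι : Type) (E : Set ℝ) (e : ℝ → H) (M : ℝ) (F : ι → H) (J : Finset ι)
      (lam : ι → ℝ), volume E ≠ ∞ → StronglyMeasurable e → (∀ t, ‖e t‖ ≤ M) →
      (∀ t s, t ≠ s → ‖inner ℂ (e t) (e s)‖ ≤ |t - s| ^ (-(1 / 2) : ℝ)) → Orthonormal ℂ F →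
      ∑ j ∈ J, |lam j| * ∫ t in E, ‖inner ℂ (e t) (F j)‖ ^ 2 ≤
        C * (∑ j ∈ J, |lam j| ^ α) ^ (1 / α) * volume.real E ^ (1 / 2 : ℝ) := by
  rcases hα.eq_or_lt with rfl | hα1
  · set K : ℝ := 2 * 256 ^ (1 / 2 : ℝ) * (2 / (1 / 2) + 1) with hK
    have hK0 : 0 < K := by positivity
    refine ⟨K ^ (1 / 3 : ℝ), by positivity, fun ι E e M F J lam hE he hM hκ hF => ?_⟩
    rcases (measureReal_nonneg (μ := volume) (s := E)).eq_or_lt with h0 | h0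
    · have : volume E = 0 := by
        rwa [eq_comm, measureReal_eq_zero_iff hE] at h0
      simp [Measure.restrict_eq_zero.2 this, ← h0]
    have hb : ∀ j, ∫ t in E, ‖inner ℂ (e t) (F j)‖ ^ 2 ≤
        K ^ (1 / 3 : ℝ) * volume.real E ^ (1 / 2 : ℝ) := fun j => by
      have hn : 0 ≤ ∫ t in E, ‖inner ℂ (e t) (F j)‖ ^ 2 := integral_nonneg fun t => sq_nonneg _
      rcases hn.eq_or_lt with h | h
      · rw [← h]; positivity
      · have := card_mul_rpow_le hE h0 he hM hκ (θ := 1 / 2) (by norm_num) (by norm_num) hF {j} h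
          (by simp)
        rw [Finset.card_singleton, Nat.cast_one, one_mul] at this
        have h2 := Real.rpow_le_rpow (by positivity) this (show (0 : ℝ) ≤ 1 / 3 by norm_num)
        rw [← Real.rpow_mul hn, Real.mul_rpow (by positivity) (by positivity),
          ← Real.rpow_mul h0.le] at h2
        norm_num at h2 ⊢
        simpa only [hK, one_div, show (2 : ℝ) / (1 / 2) + 1 = 5 by norm_num] using h2
    calc _ ≤ ∑ j ∈ J, |lam j| * (K ^ (1 / 3 : ℝ) * volume.real E ^ (1 / 2 : ℝ)) :=
          Finset.sum_le_sum fun j _ => mul_le_mul_of_nonneg_left (hb j) (abs_nonneg _)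
      _ = _ := by simp only [Real.rpow_one, div_one]; rw [← Finset.sum_mul]; ring
  · have hconj : α.HolderConjugate (Real.conjExponent α) := Real.HolderConjugate.conjExponent hα1
    set β := Real.conjExponent α with hβ
    have hβ2 : 2 < β := by
      rw [hβ, Real.conjExponent, lt_div_iff₀ (by linarith)]; linarith
    set θ := min (1 / 2) ((β - 2) / 4) with hθ
    have hθ0 : 0 < θ := lt_min (by norm_num) (by linarith)
    have hθ1 : θ < 1 := (min_le_left _ _).trans_lt (by norm_num)
    have hpβ : 2 * (1 + θ) < β := by
      have : θ ≤ (β - 2) / 4 := min_le_right _ _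
      linarith
    set p := 2 * (1 + θ) with hp
    have hp0 : 0 < p := by positivity
    set K : ℝ := 2 * 256 ^ θ * (2 / θ + 1) with hK
    have hK0 : 0 < K := by positivity
    set Z : ℝ := ∑' m : ℕ, (((m : ℝ) + 1) ^ (β / p))⁻¹ with hZ
    have hZ0 : 0 ≤ Z := tsum_nonneg fun m => by positivity
    refine ⟨K ^ (1 / p) * Z ^ (1 / β) + 1, by positivity,
      fun ι E e M F J lam hE he hM hκ hF => ?_⟩
    rcases (measureReal_nonneg (μ := volume) (s := E)).eq_or_lt with h0 | h0
    · have : volume E = 0 := by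
        rwa [eq_comm, measureReal_eq_zero_iff hE] at h0
      simp [Measure.restrict_eq_zero.2 this, ← h0]
    set a : ι → ℝ := fun j => ∫ t in E, ‖inner ℂ (e t) (F j)‖ ^ 2 with ha
    have ha0 : ∀ j, 0 ≤ a j := fun j => integral_nonneg fun t => sq_nonneg _
    have h1 := sum_rpow_le_of_card_mul_rpow_le ha0
      (D := K * volume.real E ^ (1 + θ)) (by positivity) hp0 hpβ
      (fun J σ hσ hJ => card_mul_rpow_le hE h0 he hM hκ hθ0 hθ1 hF J hσ hJ) J
    have h2 : (∑ j ∈ J, a j ^ β) ^ (1 / β) ≤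
        (K ^ (1 / p) * Z ^ (1 / β)) * volume.real E ^ (1 / 2 : ℝ) := by
      have hβ0 : 0 < β := by linarith
      refine (Real.rpow_le_rpow (Finset.sum_nonneg fun j _ => Real.rpow_nonneg (ha0 j) _) h1
        (by positivity)).trans (le_of_eq ?_)
      rw [Real.mul_rpow (by positivity) hZ0, ← Real.rpow_mul (by positivity),
        Real.mul_rpow hK0.le (by positivity), ← Real.rpow_mul h0.le,
        show β / p * (1 / β) = 1 / p by field_simp,
        show (1 + θ) * (1 / p) = 1 / 2 by rw [hp]; field_simp]
      ring
    have h3 := Real.inner_le_Lp_mul_Lq_of_nonneg J hconj (f := fun j => |lam j|) (g := a)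
      (fun j _ => abs_nonneg _) fun j _ => ha0 j
    refine h3.trans ((mul_le_mul_of_nonneg_left h2 ?_).trans ?_)
    · exact Real.rpow_nonneg (Finset.sum_nonneg fun j _ => Real.rpow_nonneg (abs_nonneg _) _) _
    · have : 0 ≤ (∑ j ∈ J, |lam j| ^ α) ^ (1 / α) :=
        Real.rpow_nonneg (Finset.sum_nonneg fun j _ => Real.rpow_nonneg (abs_nonneg _) _) _
      have : 0 ≤ (∑ j ∈ J, |lam j| ^ α) ^ (1 / α) * volume.real E ^ (1 / 2 : ℝ) := by positivity
      nlinarith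

open scoped FourierTransform

/-- The oscillating factor of the free propagator in the frequency variable `ξ / (2π)`. -/
def propagatorPhase (t : ℝ) (x η : Rn 1) : ℂ :=
  Complex.exp (((2 * π * inner ℝ x η - 4 * π ^ 2 * t * ‖η‖ ^ 2 : ℝ) : ℂ) * Complex.I)

lemma norm_propagatorPhase (t : ℝ) (x η : Rn 1) : ‖propagatorPhase t x η‖ = 1 :=
  Complex.norm_exp_ofReal_mul_I _

lemma dotC_eq_inner {n : ℕ} (x ξ : Rn n) : dotC x ξ = ((inner ℝ x ξ : ℝ) : ℂ) := by
  simp [dotC, PiLp.inner_apply, mul_comm]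

lemma FT_two_pi_smul {n : ℕ} (f : Rn n → ℂ) (η : Rn n) : FT f ((2 * π) • η) = 𝓕 f η := by
  rw [FT, Real.fourier_eq]
  refine integral_congr_ae (.of_forall fun x => ?_)
  simp only [dotC_eq_inner, Circle.smul_def, Real.fourierChar_apply, smul_eq_mul,
    inner_smul_right]
  congr 2
  push_cast
  ring

lemma schrodinger_eq_integral_fourier (f : Rn 1 → ℂ) (t : ℝ) (x : Rn 1) :
    schrodinger f t x = ∫ η, propagatorPhase t x η * 𝓕 f η := by
  have h := Measure.integral_comp_smul (volume : Measure (Rn 1))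
    (fun ξ => Complex.exp (Complex.I * (dotC x ξ - (t : ℂ) * ((‖ξ‖ : ℝ) : ℂ) ^ 2)) *
      ((1 : ℂ) * FT f ξ)) (2 * π)
  rw [schrodinger, prop]
  have hpi : 0 < 2 * π := by positivity
  rw [finrank_euclideanSpace, Fintype.card_fin, pow_one, abs_of_pos (inv_pos.2 hpi)] at h
  rw [Nat.cast_one, Real.rpow_neg_one, ← h]
  refine integral_congr_ae (.of_forall fun η => ?_)
  simp only [FT_two_pi_smul, one_mul, propagatorPhase, dotC_eq_inner, inner_smul_right,
    norm_smul, Real.norm_of_nonneg hpi.le]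
  congr 2
  push_cast
  ring

lemma integrable_of_schrodinger_ne_zero {f : Rn 1 → ℂ} {t : ℝ} {x : Rn 1}
    (h : schrodinger f t x ≠ 0) : Integrable f ∧ Integrable (𝓕 f) := by
  rw [schrodinger_eq_integral_fourier] at h
  constructor
  · by_contra hf
    refine h ?_
    have : 𝓕 f = 0 := by
      ext η
      rw [Real.fourier_eq]
      refine integral_undef fun hi => hf ?_
      rwa [Real.fourierIntegral_convergent_iff] at hi
    simp [this]
  · have hi := Integrable.of_integral_ne_zero h
    have hc : Continuous fun η => propagatorPhase t x η := by
      unfold propagatorPhase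
      fun_prop
    have : 𝓕 f = fun η => (propagatorPhase t x η)⁻¹ * (propagatorPhase t x η * 𝓕 f η) := by
      ext η
      have h0 : propagatorPhase t x η ≠ 0 := norm_ne_zero_iff.1 (by simp [norm_propagatorPhase])
      field_simp
    rw [this]
    refine hi.bdd_mul (c := 1) (hc.inv₀ fun η =>
      norm_ne_zero_iff.1 (by simp [norm_propagatorPhase])).aestronglyMeasurable ?_
    exact .of_forall fun η => by simp [norm_propagatorPhase]

lemma fourier_toLp_coeFn_ae_eq {V : Type*} [NormedAddCommGroup V] [InnerProductSpace ℝ V]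
    [FiniteDimensional ℝ V] [MeasurableSpace V] [BorelSpace V] {f : V → ℂ}
    (hf : Integrable f) (hf2 : MemLp f 2) :
    ((𝓕 (hf2.toLp f) : Lp ℂ 2 (volume : Measure V)) : V → ℂ) =ᵐ[volume] 𝓕 f := by
  have hcont : Continuous (𝓕 f) :=
    VectorFourier.fourierIntegral_continuous Real.continuous_fourierChar
      (by exact continuous_inner) hf
  refine ae_eq_of_integral_contDiff_smul_eq
    ((Lp.memLp _).locallyIntegrable (by norm_num)) hcont.locallyIntegrable fun g hg hgc => ?_
  have hg1 : HasCompactSupport fun v => (g v : ℂ) := hgc.comp_left Complex.ofReal_zero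
  let G : SchwartzMap V ℂ := hg1.toSchwartzMap (Complex.ofRealCLM.contDiff.comp hg)
  have hG : ∀ v, G v = (g v : ℂ) := fun v => rfl
  have h1 := congrArg (fun T => T G) (Lp.fourier_toTemperedDistribution_eq (hf2.toLp f))
  simp only [Lp.toTemperedDistribution_apply, TemperedDistribution.fourier_apply] at h1
  have h2 := VectorFourier.integral_fourierIntegral_smul_eq_flip (μ := volume) (ν := volume)
    (L := innerₗ V) Real.continuous_fourierChar (by exact continuous_inner) G.integrable hf
  have h2' : ∫ ξ, 𝓕 G ξ • f ξ = ∫ x, G x • 𝓕 f x := by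
    rw [SchwartzMap.fourier_coe]
    simpa using! h2
  have h3 : ∫ v, 𝓕 G v • (hf2.toLp f : V → ℂ) v = ∫ v, 𝓕 G v • f v :=
    integral_congr_ae (by filter_upwards [hf2.coeFn_toLp] with v hv; rw [hv])
  have h4 := h1.symm.trans (h3.trans h2')
  simpa [hG] using h4

/-- The complex conjugate of the propagator phase, damped by a Gaussian of parameter `ε`. -/
def dampedPhase (ε : ℝ) (p : ℝ × Rn 1) (η : Rn 1) : ℂ :=
  Complex.exp (-((ε : ℂ) - 4 * π ^ 2 * p.1 * Complex.I) * (‖η‖ : ℂ) ^ 2 +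
    (-(2 * π * Complex.I)) * ((inner ℝ p.2 η : ℝ) : ℂ))

lemma conj_dampedPhase (ε : ℝ) (p : ℝ × Rn 1) (η : Rn 1) :
    (starRingEnd ℂ) (dampedPhase ε p η) =
      Real.exp (-ε * ‖η‖ ^ 2) * propagatorPhase p.1 p.2 η := by
  rw [dampedPhase, ← Complex.exp_conj, propagatorPhase, Complex.ofReal_exp, ← Complex.exp_add]
  simp only [map_add, map_mul, map_neg, map_sub, map_pow, Complex.conj_ofReal, Complex.conj_I,
    map_ofNat]
  congr 1
  push_cast
  ring

lemma norm_dampedPhase (ε : ℝ) (p : ℝ × Rn 1) (η : Rn 1) :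
    ‖dampedPhase ε p η‖ = Real.exp (-ε * ‖η‖ ^ 2) := by
  rw [← RCLike.norm_conj, conj_dampedPhase, norm_mul, norm_propagatorPhase, mul_one,
    Complex.norm_real, Real.norm_of_nonneg (Real.exp_nonneg _)]

lemma conj_mul_dampedPhase (ε : ℝ) (p q : ℝ × Rn 1) (η : Rn 1) :
    (starRingEnd ℂ) (dampedPhase ε p η) * dampedPhase ε q η =
      Complex.exp (-(2 * ε + 4 * π ^ 2 * (p.1 - q.1) * Complex.I) * (‖η‖ : ℂ) ^ 2 +
        (2 * π * Complex.I) * ((inner ℝ (p.2 - q.2) η : ℝ) : ℂ)) := by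
  rw [conj_dampedPhase, propagatorPhase, dampedPhase, Complex.ofReal_exp, ← Complex.exp_add,
    ← Complex.exp_add, inner_sub_left]
  congr 1
  push_cast
  ring

lemma memLp_dampedPhase {ε : ℝ} (hε : 0 < ε) (p : ℝ × Rn 1) :
    MemLp (dampedPhase ε p) 2 := by
  have hc : Continuous (dampedPhase ε p) := by
    unfold dampedPhase
    fun_prop
  rw [memLp_two_iff_integrable_sq_norm hc.aestronglyMeasurable]
  have h := (GaussianFourier.integrable_cexp_neg_mul_sq_norm_add (V := Rn 1)
    (b := ((2 * ε : ℝ) : ℂ)) (by simpa using hε) 0 0).norm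
  refine h.congr (.of_forall fun η => ?_)
  simp only [norm_dampedPhase, Complex.norm_exp, ← Real.exp_nat_mul]
  congr 1
  simp [← Complex.ofReal_pow]
  ring

/-- The damped phase as an element of `L²`. -/
def dampedWave {ε : ℝ} (hε : 0 < ε) (p : ℝ × Rn 1) : Lp ℂ 2 (volume : Measure (Rn 1)) :=
  (memLp_dampedPhase hε p).toLp _

/-- The inner products of the damped waves. -/
def dampedKernel (ε : ℝ) (p q : ℝ × Rn 1) : ℂ :=
  (π / (2 * ε + 4 * π ^ 2 * (p.1 - q.1) * Complex.I)) ^ ((1 : ℂ) / 2) *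
    Complex.exp ((2 * π * Complex.I) ^ 2 * (‖p.2 - q.2‖ : ℂ) ^ 2 /
      (4 * (2 * ε + 4 * π ^ 2 * (p.1 - q.1) * Complex.I)))

lemma inner_dampedWave {ε : ℝ} (hε : 0 < ε) (p q : ℝ × Rn 1) :
    inner ℂ (dampedWave hε p) (dampedWave hε q) = dampedKernel ε p q := by
  have hre : 0 < (2 * ε + 4 * π ^ 2 * (p.1 - q.1) * Complex.I : ℂ).re := by
    simp [← Complex.ofReal_pow, ← Complex.ofReal_sub, hε]
  have h := GaussianFourier.integral_cexp_neg_mul_sq_norm_add hre (2 * π * Complex.I)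
    (p.2 - q.2)
  rw [dampedKernel, L2.inner_def]
  rw [finrank_euclideanSpace, Fintype.card_fin, Nat.cast_one] at h
  rw [← h]
  refine integral_congr_ae ?_
  filter_upwards [(memLp_dampedPhase hε p).coeFn_toLp, (memLp_dampedPhase hε q).coeFn_toLp]
    with η hp hq
  rw [dampedWave, dampedWave, hp, hq, ← conj_mul_dampedPhase]
  simp [mul_comm]

lemma norm_dampedKernel_le {ε : ℝ} (hε : 0 < ε) (p q : ℝ × Rn 1) :
    ‖dampedKernel ε p q‖ ≤
      (π / ‖(2 * ε + 4 * π ^ 2 * (p.1 - q.1) * Complex.I : ℂ)‖) ^ (1 / 2 : ℝ) := by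
  have hre : 0 < (2 * ε + 4 * π ^ 2 * (p.1 - q.1) * Complex.I : ℂ).re := by
    simp [← Complex.ofReal_pow, ← Complex.ofReal_sub, hε]
  set b : ℂ := 2 * ε + 4 * π ^ 2 * (p.1 - q.1) * Complex.I with hb
  have hb0 : b ≠ 0 := by
    intro h
    simp [h] at hre
  rw [dampedKernel, ← hb, norm_mul]
  have h1 : ‖(π / b : ℂ) ^ ((1 : ℂ) / 2)‖ = (π / ‖b‖) ^ (1 / 2 : ℝ) := by
    have : ((1 : ℂ) / 2) = ((1 / 2 : ℝ) : ℂ) := by push_cast; rfl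
    rw [this, Complex.norm_cpow_real]
    simp [abs_of_pos pi_pos]
  have h2 : ‖Complex.exp ((2 * π * Complex.I) ^ 2 * (‖p.2 - q.2‖ : ℂ) ^ 2 / (4 * b))‖ ≤ 1 := by
    rw [Complex.norm_exp, Real.exp_le_one_iff]
    have : (2 * π * Complex.I) ^ 2 * (‖p.2 - q.2‖ : ℂ) ^ 2 / (4 * b) =
        ((-(π ^ 2 * ‖p.2 - q.2‖ ^ 2) : ℝ) : ℂ) * b⁻¹ := by
      rw [mul_pow, Complex.I_sq]
      push_cast
      field_simp
      norm_num
      ring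
    rw [this, Complex.re_ofReal_mul, Complex.inv_re]
    have : 0 ≤ b.re / Complex.normSq b := div_nonneg hre.le (Complex.normSq_nonneg _)
    nlinarith [mul_nonneg (by positivity : 0 ≤ π ^ 2 * ‖p.2 - q.2‖ ^ 2) this]
  rw [h1]
  exact mul_le_of_le_one_right (by positivity) h2

lemma norm_inner_dampedWave_le {ε : ℝ} (hε : 0 < ε) {p q : ℝ × Rn 1} (h : p.1 ≠ q.1) :
    ‖inner ℂ (dampedWave hε p) (dampedWave hε q)‖ ≤ |p.1 - q.1| ^ (-(1 / 2) : ℝ) := by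
  rw [inner_dampedWave]
  refine (norm_dampedKernel_le hε p q).trans ?_
  have hd : 0 < |p.1 - q.1| := abs_pos.2 (sub_ne_zero.2 h)
  rw [Real.rpow_neg hd.le, ← Real.inv_rpow hd.le]
  refine Real.rpow_le_rpow (by positivity) ?_ (by norm_num)
  have h1 : 4 * π ^ 2 * |p.1 - q.1| ≤
      ‖(2 * ε + 4 * π ^ 2 * (p.1 - q.1) * Complex.I : ℂ)‖ := by
    refine le_trans (le_of_eq ?_) (Complex.abs_im_le_norm _)
    simp [← Complex.ofReal_pow, ← Complex.ofReal_sub, abs_mul]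
  rw [← one_div, div_le_div_iff₀ (lt_of_lt_of_le (by positivity) h1) hd, one_mul]
  refine le_trans ?_ h1
  have := pi_gt_three
  gcongr
  nlinarith

lemma norm_dampedWave_le {ε : ℝ} (hε : 0 < ε) (p : ℝ × Rn 1) :
    ‖dampedWave hε p‖ ≤ ‖dampedWave hε 0‖ := by
  have h : ∀ p, ‖dampedWave hε p‖ ^ 2 = ‖dampedKernel ε 0 0‖ := fun p => by
    have := inner_dampedWave hε p p
    rw [inner_self_eq_norm_sq_to_K] at this
    have h2 : dampedKernel ε p p = dampedKernel ε 0 0 := by simp [dampedKernel]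
    rw [← h2, ← this]
    simp
  refine le_of_eq ((sq_eq_sq₀ (norm_nonneg _) (norm_nonneg _)).1 ?_)
  rw [h, h]

lemma continuous_dampedWave {ε : ℝ} (hε : 0 < ε) : Continuous (dampedWave hε) := by
  rw [continuous_iff_continuousAt]
  intro p
  have hre : ∀ q : ℝ × Rn 1, 0 < (2 * ε + 4 * π ^ 2 * (p.1 - q.1) * Complex.I : ℂ).re := by
    simp [← Complex.ofReal_pow, ← Complex.ofReal_sub, hε]
  have hb0 : ∀ q : ℝ × Rn 1, (2 * ε + 4 * π ^ 2 * (p.1 - q.1) * Complex.I : ℂ) ≠ 0 := by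
    intro q h
    have := hre q
    simp [h] at this
  have hK : Continuous (dampedKernel ε p) := by
    unfold dampedKernel
    refine Continuous.mul ?_ ?_
    · refine Continuous.cpow (.div continuous_const (by fun_prop) hb0) continuous_const ?_
      intro q
      refine Or.inl ?_
      rw [div_eq_mul_inv, Complex.re_ofReal_mul, Complex.inv_re]
      exact mul_pos pi_pos (div_pos (hre q) (Complex.normSq_pos.2 (hb0 q)))
    · refine Complex.continuous_exp.comp (.div (by fun_prop) (by fun_prop) fun q => ?_)
      exact mul_ne_zero (by norm_num) (hb0 q)
  have hpp : ∀ q, ‖dampedWave hε q‖ ^ 2 = (dampedKernel ε p p).re := fun q => by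
    have h2 : dampedKernel ε p p = dampedKernel ε q q := by simp [dampedKernel]
    rw [h2, ← inner_dampedWave hε q q, inner_self_eq_norm_sq_to_K]
    simp [← Complex.ofReal_pow]
  rw [ContinuousAt, tendsto_iff_norm_sub_tendsto_zero]
  have hsq : ∀ q, ‖dampedWave hε q - dampedWave hε p‖ =
      √(2 * (dampedKernel ε p p).re - 2 * (dampedKernel ε p q).re) := fun q => by
    rw [← Real.sqrt_sq (norm_nonneg _), norm_sub_rev, @norm_sub_sq ℂ, inner_dampedWave, hpp, hpp]
    congr 1
    simp only [RCLike.re_to_complex]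
    ring
  simp_rw [hsq]
  have : Continuous fun q => √(2 * (dampedKernel ε p p).re - 2 * (dampedKernel ε p q).re) :=
    (continuous_const.sub (continuous_const.mul (Complex.continuous_re.comp hK))).sqrt
  simpa using this.tendsto p

lemma inner_dampedWave_fourier {f : Rn 1 → ℂ} (hf : Integrable f) (hf2 : MemLp f 2)
    {ε : ℝ} (hε : 0 < ε) (p : ℝ × Rn 1) :
    inner ℂ (dampedWave hε p) (𝓕 (hf2.toLp f) : Lp ℂ 2 (volume : Measure (Rn 1))) =
      ∫ η, (Real.exp (-ε * ‖η‖ ^ 2) : ℂ) * (propagatorPhase p.1 p.2 η * 𝓕 f η) := by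
  rw [L2.inner_def]
  refine integral_congr_ae ?_
  filter_upwards [(memLp_dampedPhase hε p).coeFn_toLp, fourier_toLp_coeFn_ae_eq hf hf2]
    with η hp hq
  rw [dampedWave, hp, hq, ← mul_assoc, ← conj_dampedPhase]
  simp [mul_comm]

lemma continuous_fourier_of_integrable {f : Rn 1 → ℂ} (hf : Integrable f) : Continuous (𝓕 f) :=
  VectorFourier.fourierIntegral_continuous Real.continuous_fourierChar
    (by exact continuous_inner) hf

lemma continuous_schrodinger {f : Rn 1 → ℂ} (hf : Integrable f) (hf1 : Integrable (𝓕 f)) :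
    Continuous fun p : ℝ × Rn 1 => schrodinger f p.1 p.2 := by
  simp only [schrodinger_eq_integral_fourier]
  have hc := continuous_fourier_of_integrable hf
  refine continuous_of_dominated (bound := fun η => ‖𝓕 f η‖) (fun p => ?_)
    (fun p => .of_forall fun η => ?_) hf1.norm (.of_forall fun η => ?_)
  · refine Continuous.aestronglyMeasurable (.mul ?_ hc)
    unfold propagatorPhase
    fun_prop
  · simp [norm_propagatorPhase]
  · refine .mul ?_ continuous_const
    unfold propagatorPhase
    fun_prop

lemma norm_schrodinger_le (f : Rn 1 → ℂ) (t : ℝ) (x : Rn 1) :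
    ‖schrodinger f t x‖ ≤ ∫ η, ‖𝓕 f η‖ := by
  rw [schrodinger_eq_integral_fourier]
  refine (norm_integral_le_integral_norm _).trans (le_of_eq ?_)
  simp [norm_propagatorPhase]

lemma continuous_schrodinger_of_any (f : Rn 1 → ℂ) :
    Continuous fun p : ℝ × Rn 1 => schrodinger f p.1 p.2 := by
  by_cases h : Integrable f ∧ Integrable (𝓕 f)
  · exact continuous_schrodinger h.1 h.2
  · have : (fun p : ℝ × Rn 1 => schrodinger f p.1 p.2) = fun _ => 0 := by
      ext p
      by_contra h0
      exact h (integrable_of_schrodinger_ne_zero h0)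
    rw [this]
    exact continuous_const

lemma tendsto_inner_dampedWave_fourier {f : Rn 1 → ℂ} (hf : Integrable f)
    (hf1 : Integrable (𝓕 f)) (p : ℝ × Rn 1) {ε : ℕ → ℝ} (hε : ∀ n, 0 < ε n)
    (h0 : Filter.Tendsto ε Filter.atTop (nhds 0)) :
    Filter.Tendsto
      (fun n => ∫ η, (Real.exp (-ε n * ‖η‖ ^ 2) : ℂ) * (propagatorPhase p.1 p.2 η * 𝓕 f η))
      Filter.atTop (nhds (schrodinger f p.1 p.2)) := by
  rw [schrodinger_eq_integral_fourier]
  have hc := continuous_fourier_of_integrable hf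
  refine tendsto_integral_of_dominated_convergence (fun η => ‖𝓕 f η‖) (fun n => ?_) hf1.norm
    (fun n => .of_forall fun η => ?_) (.of_forall fun η => ?_)
  · refine Continuous.aestronglyMeasurable (.mul (by fun_prop) (.mul ?_ hc))
    unfold propagatorPhase
    fun_prop
  · rw [norm_mul, norm_mul, norm_propagatorPhase, one_mul, Complex.norm_real,
      Real.norm_of_nonneg (Real.exp_nonneg _)]
    refine mul_le_of_le_one_left (norm_nonneg _) (Real.exp_le_one_iff.2 ?_)
    have := (hε n).le
    rw [neg_mul]
    exact neg_nonpos.2 (by positivity)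
  · have h1 : Filter.Tendsto (fun n => ((Real.exp (-ε n * ‖η‖ ^ 2) : ℝ) : ℂ)) Filter.atTop
        (nhds ((Real.exp (-0 * ‖η‖ ^ 2) : ℝ) : ℂ)) :=
      (Complex.continuous_ofReal.tendsto _).comp
        ((Real.continuous_exp.tendsto _).comp ((h0.neg).mul_const _))
    simpa using h1.mul_const (propagatorPhase p.1 p.2 η * 𝓕 f η)

lemma norm_damped_integral_le (f : Rn 1 → ℂ) (hf1 : Integrable (𝓕 f)) (p : ℝ × Rn 1)
    {ε : ℝ} (hε : 0 < ε) :
    ‖∫ η, (Real.exp (-ε * ‖η‖ ^ 2) : ℂ) * (propagatorPhase p.1 p.2 η * 𝓕 f η)‖ ≤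
      ∫ η, ‖𝓕 f η‖ := by
  refine (norm_integral_le_integral_norm _).trans
    (integral_mono_of_nonneg (.of_forall fun _ => norm_nonneg _) hf1.norm (.of_forall fun η => ?_))
  simp only [norm_mul, norm_propagatorPhase, one_mul, Complex.norm_real]
  rw [Real.norm_of_nonneg (Real.exp_nonneg _)]
  refine mul_le_of_le_one_left (norm_nonneg _) (Real.exp_le_one_iff.2 ?_)
  rw [neg_mul]
  exact neg_nonpos.2 (by positivity)

lemma OS.OrthonormalL2.memLp {f : ℕ → Rn 1 → ℂ} (h : OrthonormalL2 f) {j : ℕ}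
    (hj : Integrable (f j)) : MemLp (f j) 2 := by
  rw [memLp_two_iff_integrable_sq_norm hj.aestronglyMeasurable]
  have h1 : Integrable fun x => f j x * (starRingEnd ℂ) (f j x) :=
    Integrable.of_integral_ne_zero (by rw [h j j]; simp)
  refine h1.norm.congr (.of_forall fun x => ?_)
  simp [sq]

theorem exists_sum_mul_integral_schrodinger_le {α : ℝ} (hα : 1 ≤ α) (hα2 : α < 2) :
    ∃ C, 0 < C ∧ ∀ (f : ℕ → Rn 1 → ℂ) (lam : ℕ → ℝ) (J : Finset ℕ) (E : Set ℝ) (x : ℝ → Rn 1),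
      OrthonormalL2 f → volume E ≠ ∞ → Measurable x →
      ∑ j ∈ J, |lam j| * ∫ t in E, ‖schrodinger (f j) t (x t)‖ ^ 2 ≤
        C * (∑ j ∈ J, |lam j| ^ α) ^ (1 / α) * volume.real E ^ (1 / 2 : ℝ) := by
  classical
  obtain ⟨C, hC, hK⟩ :=
    exists_sum_mul_integral_le (Lp ℂ 2 (volume : Measure (Rn 1))) hα hα2
  refine ⟨C, hC, fun f lam J E x hf hE hx => ?_⟩
  let good : ℕ → Prop := fun j => Integrable (f j) ∧ Integrable (𝓕 (f j))
  let F : {j // good j} → Lp ℂ 2 (volume : Measure (Rn 1)) :=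
    fun j => 𝓕 ((hf.memLp j.2.1).toLp (f j))
  have hF : Orthonormal ℂ F := by
    rw [orthonormal_iff_ite]
    intro i j
    simp only [F]
    rw [Lp.inner_fourier_eq, L2.inner_def]
    have := hf j i
    rw [eq_comm] at this
    simp only [Subtype.ext_iff, eq_comm (a := (i : ℕ))]
    rw [this]
    refine integral_congr_ae ?_
    filter_upwards [(hf.memLp i.2.1).coeFn_toLp, (hf.memLp j.2.1).coeFn_toLp] with y hi hj
    rw [hi, hj]
    simp
  have hε : ∀ n : ℕ, (0 : ℝ) < 1 / ((n : ℝ) + 1) := fun n => by positivity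
  have hbound : ∀ n : ℕ, ∑ j ∈ J.subtype good, |lam j| * ∫ t in E,
      ‖inner ℂ (dampedWave (hε n) (t, x t)) (F j)‖ ^ 2 ≤
        C * (∑ j ∈ J.subtype good, |lam j| ^ α) ^ (1 / α) * volume.real E ^ (1 / 2 : ℝ) := by
    intro n
    refine hK _ E (fun t => dampedWave (hε n) (t, x t)) ‖dampedWave (hε n) 0‖ F _
      (fun j => lam j) hE ?_ (fun t => norm_dampedWave_le _ _)
      (fun t s hts => norm_inner_dampedWave_le (hε n) (p := (t, x t)) (q := (s, x s)) hts) hF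
    exact (continuous_dampedWave (hε n)).comp_stronglyMeasurable
      (measurable_id.prodMk hx).stronglyMeasurable
  have hfin : IsFiniteMeasure (volume.restrict E) := ⟨by simpa using hE.lt_top⟩
  have hlim : ∑ j ∈ J.subtype good, |lam j| * ∫ t in E, ‖schrodinger (f j) t (x t)‖ ^ 2 ≤
        C * (∑ j ∈ J.subtype good, |lam j| ^ α) ^ (1 / α) * volume.real E ^ (1 / 2 : ℝ) := by
    refine le_of_tendsto' (x := Filter.atTop) ?_ hbound
    refine tendsto_finsetSum _ fun j _ => Filter.Tendsto.const_mul _ ?_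
    refine tendsto_integral_of_dominated_convergence
      (fun _ => (∫ η, ‖𝓕 (f j) η‖) ^ 2) (fun n => ?_) (integrable_const _)
      (fun n => .of_forall fun t => ?_) (.of_forall fun t => ?_)
    · have h1 : StronglyMeasurable fun t => dampedWave (hε n) (t, x t) :=
        (continuous_dampedWave (hε n)).comp_stronglyMeasurable
          (measurable_id.prodMk hx).stronglyMeasurable
      exact ((h1.inner stronglyMeasurable_const).norm.pow 2).aestronglyMeasurable
    · simp only [F]
      rw [inner_dampedWave_fourier j.2.1, Real.norm_of_nonneg (by positivity)]
      gcongr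
      exact norm_damped_integral_le _ j.2.2 _ (hε n)
    · simp only [F]
      simp_rw [inner_dampedWave_fourier j.2.1]
      exact ((tendsto_inner_dampedWave_fourier j.2.1 j.2.2 (t, x t) hε
        tendsto_one_div_add_atTop_nhds_zero_nat).norm).pow 2
  have hsum : ∑ j ∈ J, |lam j| * ∫ t in E, ‖schrodinger (f j) t (x t)‖ ^ 2 =
      ∑ j ∈ J.subtype good, |lam j| * ∫ t in E, ‖schrodinger (f j) t (x t)‖ ^ 2 := by
    rw [Finset.sum_subtype_eq_sum_filter
      (f := fun j => |lam j| * ∫ t in E, ‖schrodinger (f j) t (x t)‖ ^ 2), Finset.sum_filter]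
    refine Finset.sum_congr rfl fun j _ => ?_
    split_ifs with hj
    · rfl
    · have : ∀ t, schrodinger (f j) t (x t) = 0 := fun t => by
        by_contra h0
        exact hj (integrable_of_schrodinger_ne_zero h0)
      simp [this]
  rw [hsum]
  refine hlim.trans ?_
  gcongr
  rw [Finset.sum_subtype_eq_sum_filter (f := fun j => |lam j| ^ α)]
  exact Finset.sum_le_sum_of_subset_of_nonneg (Finset.filter_subset _ _)
    fun _ _ _ => by positivity

lemma ofReal_rpow_sum_le_seqNormE {α : ℝ} (hα : 1 ≤ α) (lam : ℕ → ℝ) (J : Finset ℕ) :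
    ENNReal.ofReal ((∑ j ∈ J, |lam j| ^ α) ^ (1 / α)) ≤ seqNormE (ENNReal.ofReal α) lam := by
  have h0 : 0 < α := by linarith
  rw [seqNormE, if_neg ENNReal.ofReal_ne_top, ENNReal.toReal_ofReal h0.le,
    ← ENNReal.ofReal_rpow_of_nonneg (Finset.sum_nonneg fun _ _ => by positivity) (by positivity)]
  refine ENNReal.rpow_le_rpow ?_ (by positivity)
  rw [ENNReal.ofReal_sum_of_nonneg fun _ _ => by positivity]
  refine le_trans (le_of_eq ?_) (ENNReal.sum_le_tsum J)
  refine Finset.sum_congr rfl fun j _ => ?_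
  rw [ENNReal.ofReal_rpow_of_nonneg (abs_nonneg _) h0.le]

lemma exists_measurable_selection {X : Type*} [TopologicalSpace X]
    [TopologicalSpace.SeparableSpace X] [Nonempty X] [MeasurableSpace X] {P : ℝ × X → ℝ}
    (hP : Continuous P) (s : ℝ) :
    ∃ x : ℝ → X, Measurable x ∧ ∀ t, (∃ y, s < P (t, y)) → s < P (t, x t) := by
  classical
  have hU : IsOpen {t | ∃ y, s < P (t, y)} := by
    have : {t | ∃ y, s < P (t, y)} = ⋃ y, {t | s < P (t, y)} := by
      ext
      simp
    rw [this]
    exact isOpen_iUnion fun y => isOpen_lt continuous_const (by fun_prop)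
  let d := TopologicalSpace.denseSeq X
  let p : ℕ → ℝ → Prop := fun k t => s < P (t, d k) ∨ ¬ ∃ y, s < P (t, y)
  have hp : ∀ t, ∃ k, p k t := by
    intro t
    by_cases h : ∃ y, s < P (t, y)
    · have ho : IsOpen {y | s < P (t, y)} := isOpen_lt continuous_const (by fun_prop)
      obtain ⟨_, hy, k, rfl⟩ := (TopologicalSpace.denseRange_denseSeq X).inter_open_nonempty _ ho h
      exact ⟨k, Or.inl hy⟩
    · exact ⟨0, Or.inr h⟩
  refine ⟨fun t => d (Nat.find (hp t)), ?_, fun t ht => ?_⟩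
  · refine Measurable.find (f := fun k _ => d k) (fun _ => measurable_const) (fun k => ?_) hp
    have ho : IsOpen {t | s < P (t, d k)} := isOpen_lt continuous_const (by fun_prop)
    exact ho.measurableSet.union hU.measurableSet.compl
  · exact (Nat.find_spec (hp t)).resolve_right (not_not_intro ht)

/-- The partial sums of the density, with absolute values of the coefficients. -/
def partialDensity (lam : ℕ → ℝ) (f : ℕ → Rn 1 → ℂ) (N : ℕ) (p : ℝ × Rn 1) : ℝ :=
  ∑ j ∈ Finset.range N, |lam j| * ‖schrodinger (f j) p.1 p.2‖ ^ 2

lemma continuous_partialDensity (lam : ℕ → ℝ) (f : ℕ → Rn 1 → ℂ) (N : ℕ) :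
    Continuous (partialDensity lam f N) :=
  continuous_finsetSum _ fun j _ =>
    continuous_const.mul ((continuous_schrodinger_of_any (f j)).norm.pow 2)

lemma partialDensity_mono (lam : ℕ → ℝ) (f : ℕ → Rn 1 → ℂ) (p : ℝ × Rn 1) :
    Monotone fun N => partialDensity lam f N p := fun _ _ h =>
  Finset.sum_le_sum_of_subset_of_nonneg (Finset.range_mono h) fun _ _ _ => by positivity

lemma abs_density_le {lam : ℕ → ℝ} {f : ℕ → Rn 1 → ℂ} {t : ℝ} {x : Rn 1} {s : ℝ}
    (h : ∀ N, partialDensity lam f N (t, x) ≤ s) : |density lam f t x| ≤ s := by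
  have hn : ∀ j, ‖lam j * ‖schrodinger (f j) t x‖ ^ 2‖ =
      |lam j| * ‖schrodinger (f j) t x‖ ^ 2 := fun j => by simp
  have hle : ∀ N, ∑ j ∈ Finset.range N, ‖lam j * ‖schrodinger (f j) t x‖ ^ 2‖ ≤ s := fun N => by
    simp_rw [hn]
    exact h N
  have hs := summable_of_sum_range_le (fun _ => norm_nonneg _) hle
  exact (norm_tsum_le_tsum_norm hs).trans (Real.tsum_le_of_sum_range_le (fun _ => norm_nonneg _) hle)

lemma mul_sqrt_volume_le_of_lt_partialDensity {α C : ℝ}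
    (hK : ∀ (f : ℕ → Rn 1 → ℂ) (lam : ℕ → ℝ) (J : Finset ℕ) (E : Set ℝ) (x : ℝ → Rn 1),
      OrthonormalL2 f → volume E ≠ ∞ → Measurable x →
      ∑ j ∈ J, |lam j| * ∫ t in E, ‖schrodinger (f j) t (x t)‖ ^ 2 ≤
        C * (∑ j ∈ J, |lam j| ^ α) ^ (1 / α) * volume.real E ^ (1 / 2 : ℝ))
    {f : ℕ → Rn 1 → ℂ} (hf : OrthonormalL2 f) (lam : ℕ → ℝ) (N : ℕ) {s : ℝ}
    (hC : 0 < C) {E : Set ℝ} (hEm : MeasurableSet E) (hE : volume E ≠ ∞)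
    (hlt : ∀ t ∈ E, ∃ x, s < partialDensity lam f N (t, x)) :
    s * volume.real E ^ (1 / 2 : ℝ) ≤ C * (∑ j ∈ Finset.range N, |lam j| ^ α) ^ (1 / α) := by
  obtain ⟨x, hx, hxs⟩ := exists_measurable_selection (continuous_partialDensity lam f N) s
  have hfin : IsFiniteMeasure (volume.restrict E) := ⟨by simpa using hE.lt_top⟩
  have hInt : ∀ j, IntegrableOn (fun t => ‖schrodinger (f j) t (x t)‖ ^ 2) E := fun j => by
    refine integrable_of_norm_le ?_ ((∫ η, ‖𝓕 (f j) η‖) ^ 2) fun t => ?_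
    · exact ((((continuous_schrodinger_of_any (f j)).measurable.comp
        (measurable_id.prodMk hx)).norm.pow_const 2)).aestronglyMeasurable
    · rw [Real.norm_of_nonneg (by positivity)]
      gcongr
      exact norm_schrodinger_le _ _ _
  have h1 : s * volume.real E ≤
      ∑ j ∈ Finset.range N, |lam j| * ∫ t in E, ‖schrodinger (f j) t (x t)‖ ^ 2 := by
    simp_rw [← integral_const_mul]
    rw [← integral_finsetSum _ fun j _ => (hInt j).const_mul _]
    have h2 : s * volume.real E = ∫ _ in E, s := by simp [mul_comm]
    rw [h2]
    refine setIntegral_mono_on (integrable_const _)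
      (integrable_finsetSum _ fun j _ => (hInt j).const_mul _) hEm fun t ht => ?_
    exact (hxs t (hlt t ht)).le
  have h3 := h1.trans (hK f lam (Finset.range N) E x hf hE hx)
  have hL : 0 ≤ C * (∑ j ∈ Finset.range N, |lam j| ^ α) ^ (1 / α) := by
    have : 0 ≤ ∑ j ∈ Finset.range N, |lam j| ^ α := Finset.sum_nonneg fun _ _ => by positivity
    positivity
  rcases (measureReal_nonneg (μ := volume) (s := E)).eq_or_lt with h0 | h0
  · rw [← h0, Real.zero_rpow (by norm_num), mul_zero]
    exact hL
  · have hpos : 0 < volume.real E ^ (1 / 2 : ℝ) := by positivity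
    have hsq : volume.real E = volume.real E ^ (1 / 2 : ℝ) * volume.real E ^ (1 / 2 : ℝ) := by
      rw [← Real.rpow_add h0]
      norm_num
    rw [hsq, ← mul_assoc] at h3
    rw [← hsq] at h3
    exact le_of_mul_le_mul_right h3 hpos

theorem mixedWeakLp_density_le {α : ℝ} (hα : 1 ≤ α) (hα2 : α < 2) :
    ∃ C : ℝ, 0 < C ∧ ∀ (f : ℕ → Rn 1 → ℂ) (lam : ℕ → ℝ), OrthonormalL2 f →
      mixedWeakLp 2 ∞ (density lam f) ≤ ENNReal.ofReal C * seqNormE (ENNReal.ofReal α) lam := by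
  obtain ⟨C, hC, hK⟩ := exists_sum_mul_integral_schrodinger_le hα hα2
  refine ⟨C, hC, fun f lam hf => ?_⟩
  rw [mixedWeakLp, lor, if_neg (by norm_num), if_pos rfl]
  refine iSup₂_le fun s hs => ?_
  let V : ℕ → Set ℝ := fun n =>
    {t | ∃ x, s < partialDensity lam f n (t, x)} ∩ Icc (-(n : ℝ)) n
  have hVmono : Monotone V := fun m n hmn t ⟨⟨x, hx⟩, ht⟩ =>
    ⟨⟨x, hx.trans_le (partialDensity_mono lam f (t, x) hmn)⟩,
      Icc_subset_Icc (neg_le_neg (Nat.cast_le.2 hmn)) (Nat.cast_le.2 hmn) ht⟩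
  have hVm : ∀ n, MeasurableSet (V n) := fun n => by
    refine MeasurableSet.inter (IsOpen.measurableSet ?_) measurableSet_Icc
    have : {t | ∃ x, s < partialDensity lam f n (t, x)} =
        ⋃ x, {t | s < partialDensity lam f n (t, x)} := by
      ext
      simp
    rw [this]
    have := continuous_partialDensity lam f n
    exact isOpen_iUnion fun x => isOpen_lt continuous_const (by fun_prop)
  have hVf : ∀ n, volume (V n) ≠ ∞ := fun n =>
    ((measure_mono inter_subset_right).trans_lt measure_Icc_lt_top).ne
  have hV : ∀ n, ENNReal.ofReal s * volume (V n) ^ (1 / 2 : ℝ) ≤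
      ENNReal.ofReal C * seqNormE (ENNReal.ofReal α) lam := fun n => by
    have h := mul_sqrt_volume_le_of_lt_partialDensity hK hf lam n hC (hVm n) (hVf n)
      fun t ht => ht.1
    have h2 := ENNReal.ofReal_le_ofReal h
    rw [ENNReal.ofReal_mul hs.le, ENNReal.ofReal_mul hC.le,
      ← ENNReal.ofReal_rpow_of_nonneg measureReal_nonneg (by norm_num), ofReal_measureReal (hVf n)]
      at h2
    exact h2.trans (by gcongr; exact ofReal_rpow_sum_le_seqNormE hα lam _)
  have hsub : {t | ENNReal.ofReal s < eLpNorm (density lam f t) ∞ volume} ⊆ ⋃ n, V n := by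
    intro t ht
    by_contra hn
    rw [mem_ofPred_eq] at ht
    refine absurd ht (not_lt.2 ?_)
    rw [eLpNorm_exponent_top]
    refine eLpNormEssSup_le_of_ae_bound (.of_forall fun x => abs_density_le fun N => ?_)
    by_contra hlt
    obtain ⟨m, hm⟩ := exists_nat_ge |t|
    refine hn (mem_iUnion.2 ⟨max N m, ⟨x, (not_le.1 hlt).trans_le
      (partialDensity_mono lam f (t, x) (le_max_left N m))⟩, abs_le.1 (hm.trans ?_)⟩)
    exact_mod_cast le_max_right N m
  have hlim : ENNReal.ofReal s * volume (⋃ n, V n) ^ (1 / 2 : ℝ) ≤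
      ENNReal.ofReal C * seqNormE (ENNReal.ofReal α) lam := by
    refine le_of_tendsto' (x := Filter.atTop) (ENNReal.Tendsto.const_mul ?_
      (Or.inr ENNReal.ofReal_ne_top)) hV
    exact (ENNReal.continuous_rpow_const.tendsto _).comp (tendsto_measure_iUnion_atTop hVmono)
  refine le_trans ?_ hlim
  rw [ENNReal.toReal_ofNat]
  gcongr

lemma dist_eq_abs_sub_coord (η ξ : Rn 1) : dist η ξ = |η 0 - ξ 0| := by
  simp [EuclideanSpace.dist_eq, Real.dist_eq, Real.sqrt_sq_eq_abs]

lemma norm_sq_eq_coord_sq (η : Rn 1) : ‖η‖ ^ 2 = η 0 ^ 2 := by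
  simp [EuclideanSpace.norm_sq_eq]

/-- A smooth bump at distance `√(n + 1)` from the origin and of width comparable to
`1 / √(n + 1)`, so that `‖η‖ ^ 2` is within `1 / 2` of `n + 1` on its support. -/
def freqBump (n : ℕ) : ContDiffBump (EuclideanSpace.single 0 (√((n : ℝ) + 1)) : Rn 1) where
  rIn := 1 / (16 * √((n : ℝ) + 1))
  rOut := 1 / (8 * √((n : ℝ) + 1))
  rIn_pos := by positivity
  rIn_lt_rOut := by
    have : 0 < √((n : ℝ) + 1) := by positivity
    gcongr
    norm_num

lemma abs_norm_sq_sub_lt_of_freqBump_ne_zero {n : ℕ} {η : Rn 1} (h : freqBump n η ≠ 0) :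
    |‖η‖ ^ 2 - ((n : ℝ) + 1)| < 1 / 2 := by
  have hm : η ∈ Metric.ball (EuclideanSpace.single 0 (√((n : ℝ) + 1)) : Rn 1) (freqBump n).rOut := by
    rw [← (freqBump n).support_eq]
    exact h
  rw [Metric.mem_ball, dist_eq_abs_sub_coord] at hm
  simp only [PiLp.single_apply, if_true] at hm
  have hm' : |η 0 - √((n : ℝ) + 1)| < 1 / (8 * √((n : ℝ) + 1)) := hm
  rw [norm_sq_eq_coord_sq]
  have hsq : √((n : ℝ) + 1) ^ 2 = n + 1 := Real.sq_sqrt (by positivity)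
  have h1 : 1 ≤ √((n : ℝ) + 1) := Real.one_le_sqrt.2 (by linarith [n.cast_nonneg (α := ℝ)])
  rw [← hsq]
  set m := √((n : ℝ) + 1)
  have h8 : 1 / (8 * m) ≤ 1 / 8 := one_div_le_one_div_of_le (by norm_num) (by linarith)
  have h9 : 1 / (8 * m) * m = 1 / 8 := by field_simp
  rw [abs_lt] at hm' ⊢
  constructor <;> nlinarith

lemma freqBump_mul_freqBump {j k : ℕ} (h : j ≠ k) (η : Rn 1) :
    freqBump j η * freqBump k η = 0 := by
  by_contra h0
  obtain ⟨hj, hk⟩ := mul_ne_zero_iff.1 h0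
  have h1 := abs_norm_sq_sub_lt_of_freqBump_ne_zero hj
  have h2 := abs_norm_sq_sub_lt_of_freqBump_ne_zero hk
  rw [abs_lt] at h1 h2
  have h3 : (j : ℝ) < k + 1 := by linarith
  have h4 : (k : ℝ) < j + 1 := by linarith
  norm_cast at h3 h4
  omega

/-- The square of the `L²` norm of `freqBump n`. -/
def freqBumpMass (n : ℕ) : ℝ := ∫ η, freqBump n η ^ 2

lemma integrable_freqBump_sq (n : ℕ) : Integrable fun η => freqBump n η ^ 2 := by
  have h := (freqBump n).integrable (μ := volume)
  refine (h.mul_of_top_right (memLp_top_of_bound h.aestronglyMeasurable 1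
    (.of_forall fun η => ?_))).congr (.of_forall fun η => ?_)
  · rw [Real.norm_of_nonneg (freqBump n).nonneg]
    exact (freqBump n).le_one
  · simp [sq]

lemma freqBumpMass_le (n : ℕ) : freqBumpMass n ≤ ∫ η, freqBump n η :=
  integral_mono (integrable_freqBump_sq n) (freqBump n).integrable fun η => by
    have h0 := (freqBump n).nonneg (x := η)
    have h1 := (freqBump n).le_one (x := η)
    dsimp only
    nlinarith

lemma freqBumpMass_pos (n : ℕ) : 0 < freqBumpMass n := by
  have hc : Continuous fun η => freqBump n η ^ 2 := (freqBump n).continuous.pow 2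
  refine hc.integral_pos_of_hasCompactSupport_nonneg_nonzero ?_ (fun η => sq_nonneg _)
    (x := EuclideanSpace.single 0 (√((n : ℝ) + 1))) ?_
  · exact (freqBump n).hasCompactSupport.comp_left (g := fun y => y ^ 2) (by simp)
  · have := (freqBump n).pos_of_mem_ball (Metric.mem_ball_self (freqBump n).rOut_pos)
    positivity

/-- The normalized bump, as a Schwartz function. -/
def freqProfile (n : ℕ) : SchwartzMap (Rn 1) ℂ :=
  HasCompactSupport.toSchwartzMap
    (f := fun η => (((√(freqBumpMass n))⁻¹ * freqBump n η : ℝ) : ℂ))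
    ((freqBump n).hasCompactSupport.comp_left
      (g := fun y => (((√(freqBumpMass n))⁻¹ * y : ℝ) : ℂ)) (by simp))
    (Complex.ofRealCLM.contDiff.comp (contDiff_const.mul (freqBump n).contDiff))

lemma freqProfile_apply (n : ℕ) (η : Rn 1) :
    freqProfile n η = (((√(freqBumpMass n))⁻¹ * freqBump n η : ℝ) : ℂ) := rfl

/-- The function whose Fourier transform is the `n`-th normalized bump. -/
def wavePacket (n : ℕ) : SchwartzMap (Rn 1) ℂ := 𝓕⁻ (freqProfile n)

lemma fourier_wavePacket (n : ℕ) (η : Rn 1) : 𝓕 (wavePacket n : Rn 1 → ℂ) η = freqProfile n η := by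
  rw [← SchwartzMap.fourier_coe, wavePacket, FourierTransform.fourier_fourierInv_eq]

lemma orthonormalL2_wavePacket : OrthonormalL2 fun n => (wavePacket n : Rn 1 → ℂ) := by
  intro j k
  have h := SchwartzMap.integral_inner_fourier_fourier (wavePacket k) (wavePacket j)
  have h2 : ∫ x, wavePacket j x * (starRingEnd ℂ) (wavePacket k x) =
      ∫ η, (((√(freqBumpMass k))⁻¹ * (√(freqBumpMass j))⁻¹ *
        (freqBump j η * freqBump k η) : ℝ) : ℂ) := by
    calc ∫ x, wavePacket j x * (starRingEnd ℂ) (wavePacket k x)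
        = ∫ x, inner ℂ (wavePacket k x) (wavePacket j x) := by simp
      _ = _ := h.symm
      _ = _ := by
        refine integral_congr_ae (.of_forall fun η => ?_)
        simp only [wavePacket, FourierTransform.fourier_fourierInv_eq, freqProfile_apply,
          RCLike.inner_apply, Complex.conj_ofReal, ← Complex.ofReal_mul]
        congr 1
        ring
  rw [h2, integral_complex_ofReal, integral_const_mul]
  split_ifs with hjk
  · subst hjk
    have h3 : ∫ η, freqBump j η * freqBump j η = freqBumpMass j := by simp [freqBumpMass, sq]
    rw [h3, ← mul_inv, Real.mul_self_sqrt (freqBumpMass_pos j).le,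
      inv_mul_cancel₀ (freqBumpMass_pos j).ne']
    simp
  · simp [freqBump_mul_freqBump hjk]

lemma integral_freqBump_le_norm_schrodinger (n : ℕ) {t : ℝ} (ht : |t| ≤ 1 / (4 * π ^ 2)) :
    1 / 2 * ((√(freqBumpMass n))⁻¹ * ∫ η, freqBump n η) ≤
      ‖schrodinger (wavePacket n) t 0‖ := by
  set c := (√(freqBumpMass n))⁻¹ with hc
  have hc0 : 0 ≤ c := by positivity
  set z : ℂ := Complex.exp (((4 * π ^ 2 * t * (n + 1) : ℝ) : ℂ) * Complex.I) with hz
  have hzn : ‖z‖ = 1 := Complex.norm_exp_ofReal_mul_I _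
  have hInt : Integrable fun η => z * (propagatorPhase t 0 η * (freqProfile n η)) := by
    refine Integrable.const_mul ((freqProfile n).integrable.bdd_mul (c := 1) ?_
      (.of_forall fun η => (norm_propagatorPhase t 0 η).le)) z
    refine Continuous.aestronglyMeasurable ?_
    unfold propagatorPhase
    fun_prop
  have hre : ∀ η, (z * (propagatorPhase t 0 η * (freqProfile n η))).re =
      Real.cos (4 * π ^ 2 * t * ((n + 1) - ‖η‖ ^ 2)) * (c * freqBump n η) := by
    intro η
    rw [freqProfile_apply, ← mul_assoc, Complex.re_mul_ofReal, hz, propagatorPhase,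
      ← Complex.exp_add, ← add_mul, ← Complex.ofReal_add, Complex.exp_ofReal_mul_I_re,
      inner_zero_left]
    congr 2
    ring
  have hle : ∀ η, 1 / 2 * (c * freqBump n η) ≤
      (z * (propagatorPhase t 0 η * (freqProfile n η))).re := by
    intro η
    rw [hre]
    by_cases h0 : freqBump n η = 0
    · simp [h0]
    · have h1 := abs_norm_sq_sub_lt_of_freqBump_ne_zero h0
      rw [abs_sub_comm] at h1
      refine mul_le_mul_of_nonneg_right ?_ (mul_nonneg hc0 (freqBump n).nonneg)
      refine le_trans ?_ (Real.one_sub_sq_div_two_le_cos)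
      have h2 : |4 * π ^ 2 * t * ((n + 1) - ‖η‖ ^ 2)| ≤ 1 * (1 / 2) := by
        rw [abs_mul]
        refine mul_le_mul ?_ h1.le (abs_nonneg _) zero_le_one
        rw [abs_mul, abs_of_pos (by positivity : 0 < 4 * π ^ 2), mul_comm]
        rwa [← le_div_iff₀ (by positivity)]
      have := sq_le_sq' (abs_le.1 h2).1 (abs_le.1 h2).2
      linarith
  calc 1 / 2 * (c * ∫ η, freqBump n η)
      = ∫ η, 1 / 2 * (c * freqBump n η) := by rw [integral_const_mul, integral_const_mul]
    _ ≤ ∫ η, (z * (propagatorPhase t 0 η * (freqProfile n η))).re :=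
        integral_mono (((freqBump n).integrable.const_mul c).const_mul _) hInt.re hle
    _ = (z * ∫ η, propagatorPhase t 0 η * (freqProfile n η)).re := by
        rw [← integral_const_mul]
        exact integral_re hInt
    _ ≤ ‖z * ∫ η, propagatorPhase t 0 η * (freqProfile n η)‖ := Complex.re_le_norm _
    _ = ‖schrodinger (wavePacket n) t 0‖ := by
        rw [norm_mul, hzn, one_mul, schrodinger_eq_integral_fourier]
        simp_rw [fourier_wavePacket]

lemma le_norm_schrodinger_wavePacket_sq (n : ℕ) {t : ℝ} (ht : |t| ≤ 1 / (4 * π ^ 2)) :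
    volume.real (Metric.ball (0 : Rn 1) 1) / 64 * (1 / √((n : ℝ) + 1)) ≤
      ‖schrodinger (wavePacket n) t 0‖ ^ 2 := by
  have h1 := (freqBump n).measure_closedBall_le_integral volume
  have hr : (freqBump n).rIn = 1 / (16 * √((n : ℝ) + 1)) := rfl
  rw [Measure.addHaar_real_closedBall _ _ (freqBump n).rIn_pos.le, finrank_euclideanSpace,
    Fintype.card_fin, pow_one, hr] at h1
  have hA := freqBumpMass_pos n
  have hAB := freqBumpMass_le n
  have h2 := integral_freqBump_le_norm_schrodinger n ht
  set A := freqBumpMass n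
  set B := ∫ η, freqBump n η
  have hB : 0 < B := hA.trans_le hAB
  calc volume.real (Metric.ball (0 : Rn 1) 1) / 64 * (1 / √((n : ℝ) + 1))
      = 1 / 4 * (1 / (16 * √((n : ℝ) + 1)) * volume.real (Metric.ball (0 : Rn 1) 1)) := by
        rw [one_div_mul_eq_div, one_div_mul_eq_div]
        field_simp
        ring
    _ ≤ 1 / 4 * B := by gcongr
    _ ≤ 1 / 4 * (B ^ 2 / A) := by
        gcongr
        rw [le_div_iff₀ hA]
        nlinarith
    _ = (1 / 2 * ((√A)⁻¹ * B)) ^ 2 := by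
        rw [mul_pow, mul_pow, inv_pow, Real.sq_sqrt hA.le]
        ring
    _ ≤ _ := by gcongr

lemma ofReal_lt_eLpNorm_top_of_continuous {X : Type*} [TopologicalSpace X] [MeasurableSpace X]
    [BorelSpace X] {μ : Measure X} [μ.IsOpenPosMeasure] {g : X → ℝ} (hg : Continuous g) {s : ℝ}
    (hs : 0 ≤ s) {x : X} (hx : s < |g x|) : ENNReal.ofReal s < eLpNorm g ∞ μ := by
  obtain ⟨s', hs', hx'⟩ := exists_between hx
  refine lt_of_lt_of_le ((ENNReal.ofReal_lt_ofReal_iff (hs.trans_lt hs')).2 hs') ?_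
  by_contra! hlt
  have hae := ae_le_eLpNormEssSup (f := g) (μ := μ)
  rw [eLpNorm_exponent_top] at hlt
  have ho : IsOpen {y | s' < |g y|} := isOpen_lt continuous_const hg.abs
  refine (ho.measure_pos μ ⟨x, hx'⟩).ne' (measure_mono_null (fun y hy => ?_) hae)
  intro hle
  have hlt2 := hle.trans_lt hlt
  rw [← ofReal_norm, ENNReal.ofReal_lt_ofReal_iff (hs.trans_lt hs')] at hlt2
  exact lt_asymm hlt2 hy

/-- The coefficients `1 / √(j + 1)`, truncated to the first `N` terms. -/
def truncCoeff (N j : ℕ) : ℝ := if j < N then 1 / √((j : ℝ) + 1) else 0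

lemma truncCoeff_sq (N j : ℕ) :
    truncCoeff N j ^ 2 = if j < N then 1 / ((j : ℝ) + 1) else 0 := by
  rw [truncCoeff]
  split_ifs
  · rw [div_pow, Real.sq_sqrt (by positivity), one_pow]
  · simp

lemma truncCoeff_nonneg (N j : ℕ) : 0 ≤ truncCoeff N j := by
  rw [truncCoeff]
  split_ifs <;> positivity

lemma truncCoeff_le_one (N j : ℕ) : truncCoeff N j ≤ 1 := by
  rw [truncCoeff]
  split_ifs
  · rw [div_le_one (by positivity)]
    exact Real.one_le_sqrt.2 (by linarith [j.cast_nonneg (α := ℝ)])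
  · exact zero_le_one

lemma seqNormE_truncCoeff_le {α : ℝ} (hα : 2 ≤ α) {N : ℕ} (hN : 0 < N) :
    seqNormE (ENNReal.ofReal α) (truncCoeff N) ≤
      ENNReal.ofReal (√(∑ j ∈ Finset.range N, 1 / ((j : ℝ) + 1))) := by
  have h0 : 0 < α := by linarith
  set L := ∑ j ∈ Finset.range N, 1 / ((j : ℝ) + 1) with hL
  have hL1 : 1 ≤ L := by
    refine le_trans ?_ (Finset.single_le_sum (f := fun j : ℕ => 1 / ((j : ℝ) + 1))
      (fun j _ => by positivity) (Finset.mem_range.2 hN))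
    simp
  rw [seqNormE, if_neg ENNReal.ofReal_ne_top, ENNReal.toReal_ofReal h0.le]
  have hsum : ∑' j, ENNReal.ofReal |truncCoeff N j| ^ α ≤ ENNReal.ofReal L := by
    rw [tsum_eq_sum (s := Finset.range N), hL, ENNReal.ofReal_sum_of_nonneg]
    · refine Finset.sum_le_sum fun j hj => ?_
      rw [ENNReal.ofReal_rpow_of_nonneg (abs_nonneg _) h0.le, abs_of_nonneg (truncCoeff_nonneg N j)]
      refine ENNReal.ofReal_le_ofReal ?_
      have h2 := truncCoeff_sq N j
      rw [if_pos (Finset.mem_range.1 hj)] at h2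
      rw [← h2, ← Real.rpow_two]
      have hpos : 0 < truncCoeff N j := by
        rw [truncCoeff, if_pos (Finset.mem_range.1 hj)]
        positivity
      exact Real.rpow_le_rpow_of_exponent_ge hpos (truncCoeff_le_one N j) hα
    · exact fun _ _ => by positivity
    · intro j hj
      rw [truncCoeff, if_neg (by simpa using hj)]
      simp [h0]
  calc _ ≤ ENNReal.ofReal L ^ (1 / α) := ENNReal.rpow_le_rpow hsum (by positivity)
    _ ≤ ENNReal.ofReal L ^ (1 / 2 : ℝ) :=
        ENNReal.rpow_le_rpow_of_exponent_le (ENNReal.one_le_ofReal.2 hL1)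
          (one_div_le_one_div_of_le (by norm_num) hα)
    _ = _ := by
        rw [ENNReal.ofReal_rpow_of_nonneg (by linarith) (by norm_num), Real.sqrt_eq_rpow]

lemma density_truncCoeff (f : ℕ → Rn 1 → ℂ) (N : ℕ) (t : ℝ) (x : Rn 1) :
    density (truncCoeff N) f t x =
      ∑ j ∈ Finset.range N, 1 / √((j : ℝ) + 1) * ‖schrodinger (f j) t x‖ ^ 2 := by
  rw [density, density2, tsum_eq_sum (s := Finset.range N)]
  · refine Finset.sum_congr rfl fun j hj => ?_
    rw [truncCoeff, if_pos (Finset.mem_range.1 hj)]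
  · intro j hj
    rw [truncCoeff, if_neg (by simpa using hj), zero_mul]

lemma continuous_density_truncCoeff (f : ℕ → Rn 1 → ℂ) (N : ℕ) (t : ℝ) :
    Continuous (density (truncCoeff N) f t) := by
  have h : density (truncCoeff N) f t = fun x =>
      ∑ j ∈ Finset.range N, 1 / √((j : ℝ) + 1) * ‖schrodinger (f j) t x‖ ^ 2 :=
    funext fun x => density_truncCoeff f N t x
  rw [h]
  have hc : ∀ j, Continuous fun x => schrodinger (f j) t x := fun j => by
    have hp : Continuous fun x : Rn 1 => ((t, x) : ℝ × Rn 1) := by fun_prop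
    have h := Continuous.comp (continuous_schrodinger_of_any (f j)) hp
    simpa only [Function.comp_def] using h
  exact continuous_finsetSum _ fun j _ => ((hc j).norm.pow 2).const_mul _

lemma le_mixedWeakLp_wavePacket {N : ℕ} (hN : 0 < N) :
    ENNReal.ofReal (volume.real (Metric.ball (0 : Rn 1) 1) / 128 *
        (∑ j ∈ Finset.range N, 1 / ((j : ℝ) + 1)) * √(1 / (4 * π ^ 2))) ≤
      mixedWeakLp 2 ∞ (density (truncCoeff N) fun n => (wavePacket n : Rn 1 → ℂ)) := by
  set L := ∑ j ∈ Finset.range N, 1 / ((j : ℝ) + 1) with hL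
  set ω := volume.real (Metric.ball (0 : Rn 1) 1) with hω
  have hωpos : 0 < ω := ENNReal.toReal_pos (Metric.measure_ball_pos _ _ one_pos).ne'
    measure_ball_lt_top.ne
  have hLpos : 0 < L := Finset.sum_pos (fun _ _ => by positivity) (Finset.nonempty_range_iff.2 hN.ne')
  have hs : 0 < ω / 128 * L := by positivity
  rw [mixedWeakLp, lor, if_neg (by norm_num), if_pos rfl]
  refine le_trans ?_ (le_iSup₂ (f := fun (s : ℝ) (_ : 0 < s) => ENNReal.ofReal s *
    volume {t | ENNReal.ofReal s < eLpNorm (density (truncCoeff N)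
      (fun n => (wavePacket n : Rn 1 → ℂ)) t) ∞ volume} ^ (1 / (2 : ℝ≥0∞).toReal))
    (ω / 128 * L) hs)
  have hsub : Icc 0 (1 / (4 * π ^ 2)) ⊆ {t | ENNReal.ofReal (ω / 128 * L) <
      eLpNorm (density (truncCoeff N) (fun n => (wavePacket n : Rn 1 → ℂ)) t) ∞ volume} := by
    intro t ht
    refine ofReal_lt_eLpNorm_top_of_continuous (continuous_density_truncCoeff _ N t) hs.le
      (x := 0) (lt_of_lt_of_le ?_ (le_abs_self _))
    · rw [density_truncCoeff]
      calc ω / 128 * L < ω / 64 * L := by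
            refine mul_lt_mul_of_pos_right ?_ hLpos
            linarith
        _ = ∑ j ∈ Finset.range N, 1 / √((j : ℝ) + 1) * (ω / 64 * (1 / √((j : ℝ) + 1))) := by
            rw [hL, Finset.mul_sum]
            refine Finset.sum_congr rfl fun j _ => ?_
            have : 1 / √((j : ℝ) + 1) * (1 / √((j : ℝ) + 1)) = 1 / ((j : ℝ) + 1) := by
              rw [div_mul_div_comm, one_mul, Real.mul_self_sqrt (by positivity)]
            linear_combination (-(ω / 64)) * this
        _ ≤ _ := by
            gcongr with j
            refine le_norm_schrodinger_wavePacket_sq j ?_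
            rw [abs_of_nonneg ht.1]
            exact ht.2
  rw [ENNReal.ofReal_mul hs.le, Real.sqrt_eq_rpow, ENNReal.toReal_ofNat,
    ← ENNReal.ofReal_rpow_of_nonneg (by positivity) (by norm_num)]
  gcongr
  refine le_trans (le_of_eq ?_) (measure_mono hsub)
  simp

lemma not_exists_mixedWeakLp_le {α : ℝ} (hα : 2 ≤ α) :
    ¬ ∃ C : ℝ, 0 < C ∧ ∀ (f : ℕ → Rn 1 → ℂ) (lam : ℕ → ℝ),
      OrthonormalL2 f → seqNormE (ENNReal.ofReal α) lam ≠ ∞ →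
      mixedWeakLp 2 ∞ (density lam f)
        ≤ ENNReal.ofReal C * seqNormE (ENNReal.ofReal α) lam := by
  rintro ⟨C, hC, h⟩
  set ω := volume.real (Metric.ball (0 : Rn 1) 1) with hω
  have hωpos : 0 < ω := ENNReal.toReal_pos (Metric.measure_ball_pos _ _ one_pos).ne'
    measure_ball_lt_top.ne
  have hκ : 0 < ω / 128 * √(1 / (4 * π ^ 2)) := by positivity
  set κ := ω / 128 * √(1 / (4 * π ^ 2)) with hκdef
  obtain ⟨N, hN, hNL⟩ := ((Real.tendsto_sum_range_one_div_nat_succ_atTop.eventually_gt_atTop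
    ((C / κ) ^ 2)).and (Filter.eventually_gt_atTop 0)).exists
  have h1 := seqNormE_truncCoeff_le hα hNL
  have h2 := (le_mixedWeakLp_wavePacket hNL).trans ((h _ (truncCoeff N) orthonormalL2_wavePacket
    (h1.trans_lt ENNReal.ofReal_lt_top).ne).trans (mul_le_mul_right h1 _))
  rw [← ENNReal.ofReal_mul hC.le, ENNReal.ofReal_le_ofReal_iff (by positivity)] at h2
  set L := ∑ j ∈ Finset.range N, 1 / ((j : ℝ) + 1) with hL
  have hLpos : 0 < L := lt_of_le_of_lt (sq_nonneg _) hN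
  have h3 : C / κ < √L := Real.lt_sqrt_of_sq_lt hN
  rw [div_lt_iff₀ hκ] at h3
  have h4 : √L * √L = L := Real.mul_self_sqrt hLpos.le
  have h5 : 0 < √L := Real.sqrt_pos.2 hLpos
  have h6 : ω / 128 * L * √(1 / (4 * π ^ 2)) = √L * κ * √L := by
    rw [hκdef]
    linear_combination (-(ω / 128 * √(1 / (4 * π ^ 2)))) * h4
  rw [← hω, h6] at h2
  exact absurd h3 (not_lt.2 (le_of_mul_le_mul_right h2 h5))

/-- (Bez–Lee–Nakamura.)  For `n = 1`, the weak-type estimate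
`‖Σ λ_j |e^{it∂ₓ²}f_j|²‖_{L^{2,∞}(ℝ, L^∞(ℝ))} ≲ ‖λ‖_{ℓ^α}` over systems orthonormal
in `L²(ℝ)` holds if and only if `α < 2`. -/
theorem weak_type_one_dim_iff (α : ℝ) (hα : 1 ≤ α) :
    (∃ C : ℝ, 0 < C ∧ ∀ (f : ℕ → Rn 1 → ℂ) (lam : ℕ → ℝ),
      OrthonormalL2 f → seqNormE (ENNReal.ofReal α) lam ≠ ∞ →
      mixedWeakLp 2 ∞ (density lam f)
        ≤ ENNReal.ofReal C * seqNormE (ENNReal.ofReal α) lam) ↔ α < 2 := by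
  refine ⟨fun h => ?_, fun hα2 => ?_⟩
  · by_contra hα2
    exact not_exists_mixedWeakLp_le (not_lt.1 hα2) h
  · obtain ⟨C, hC, h⟩ := mixedWeakLp_density_le hα hα2
    exact ⟨C, hC, fun f lam hf _ => h f lam hf⟩
end
end
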